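/- Let p₁ : (ℕ → ℝ) × (ℕ → ℝ) → (ℕ → ℝ) be the projection onto the first factor and mpcc(p₁) : mpcc((ℕ → ℝ) × (ℕ → ℝ)) → mpcc(ℕ → ℝ) the induced map A ↦ p₁ '' A on hyperspaces of nonempty compact max-plus convex subsets. Then mpcc(p₁) is a trivial bundle with fiber ℝ^ω: there exists a homeomorphism h : mpcc((ℕ → ℝ) × (ℕ → ℝ)) ≃ mpcc(ℕ → ℝ) × (ℕ → ℝ) such that the projection onto the first factor composed with h equals mpcc(p₁). -/

import Mathlib

/-- Max-plus convexity in `ι → ℝ`. -/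
def MaxPlusConvex {ι : Type*} (A : Set (ι → ℝ)) : Prop :=
  ∀ a ∈ A, ∀ b ∈ A, ∀ t : ℝ, t ≤ 0 → (fun i => max (a i) (t + b i)) ∈ A

/-- Max-plus convexity in `(ℕ → ℝ) × (ℕ → ℝ)`. -/
def MaxPlusConvexPair (A : Set ((ℕ → ℝ) × (ℕ → ℝ))) : Prop :=
  ∀ a ∈ A, ∀ b ∈ A, ∀ t : ℝ, t ≤ 0 →
    ((fun n => max (a.1 n) (t + b.1 n)), (fun n => max (a.2 n) (t + b.2 n))) ∈ A

/-- The Vietoris topology on a family of subsets of a topological space `X`. -/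
def vietoris {X : Type*} [TopologicalSpace X] (P : Set X → Prop) :
    TopologicalSpace {A : Set X // P A} :=
  TopologicalSpace.generateFrom
    {S | ∃ U : Set X, IsOpen U ∧
      (S = {K : {A : Set X // P A} | (K : Set X) ⊆ U} ∨
        S = {K : {A : Set X // P A} | ((K : Set X) ∩ U).Nonempty})}

/-- The hyperspace of nonempty compact max-plus convex subsets of `ℕ → ℝ`. -/
abbrev MPCC1 := {A : Set (ℕ → ℝ) // A.Nonempty ∧ IsCompact A ∧ MaxPlusConvex A}

/-- The hyperspace of nonempty compact max-plus convex subsets of `(ℕ → ℝ) × (ℕ → ℝ)`. -/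
abbrev MPCC2 :=
  {A : Set ((ℕ → ℝ) × (ℕ → ℝ)) // A.Nonempty ∧ IsCompact A ∧ MaxPlusConvexPair A}

lemma image_fst_mem (A : MPCC2) :
    (Prod.fst '' (A : Set ((ℕ → ℝ) × (ℕ → ℝ)))).Nonempty ∧
      IsCompact (Prod.fst '' (A : Set ((ℕ → ℝ) × (ℕ → ℝ)))) ∧
      MaxPlusConvex (Prod.fst '' (A : Set ((ℕ → ℝ) × (ℕ → ℝ)))) := by
  obtain ⟨hne, hc, hconv⟩ := A.2
  refine ⟨hne.image _, hc.image continuous_fst, ?_⟩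
  rintro a ⟨p, hp, rfl⟩ b ⟨q, hq, rfl⟩ t ht
  exact ⟨_, hconv p hp q hq t ht, rfl⟩

/-- The map `mpcc(p)` induced by the projection `p` onto the first factor. -/
noncomputable def mpccP (A : MPCC2) : MPCC1 :=
  ⟨Prod.fst '' (A : Set ((ℕ → ℝ) × (ℕ → ℝ))), image_fst_mem A⟩

section TrivialFamilies

open Set Filter Topology

/-- A subset of `T × V` is trivial over `T` with fibre `W`. -/
def TrivialOver {T V : Type*} (W : Type*) [TopologicalSpace T] [TopologicalSpace V]
    [TopologicalSpace W] (O : Set (T × V)) : Prop :=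
  ∃ h : O ≃ₜ T × W, ∀ o, (h o).1 = o.1.1

section Star

theorem exists_ray_root {T V : Type*} [AddCommGroup V] [Module ℝ V] (m : T × V → ℝ) (t : T) (y : V)
    (hcont : Continuous fun σ : ℝ => m (t, σ • y)) (hle : ∀ p, m p ≤ 1)
    (hpos : 0 < m (t, 0)) :
    ∃ σ : ℝ, 0 < σ ∧ m (t, σ • y) = σ := by
  have h1 : ContinuousOn (fun σ : ℝ => σ - m (t, σ • y)) (Icc 0 1) :=
    (continuous_id.sub hcont).continuousOn
  have h2 := intermediate_value_Icc (zero_le_one) h1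
  have h3 : (0 : ℝ) ∈ Icc (0 - m (t, (0 : ℝ) • y)) (1 - m (t, (1 : ℝ) • y)) := by
    constructor
    · rw [zero_smul]; linarith
    · linarith [hle (t, (1 : ℝ) • y)]
  obtain ⟨σ, hσ, hσ'⟩ := h2 h3
  have hσ'' : m (t, σ • y) = σ := by simp only at hσ'; linarith
  refine ⟨σ, lt_of_le_of_ne hσ.1 ?_, hσ''⟩
  rintro rfl
  rw [zero_smul] at hσ''
  linarith

variable {T V : Type*} [TopologicalSpace T] [AddCommGroup V] [Module ℝ V] [TopologicalSpace V]
  [ContinuousSMul ℝ V]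

/-- The region of positivity of a continuous function that is antitone along rays is trivial. -/
theorem trivialOver_of_antitone_rays (m : T × V → ℝ) (hm : Continuous m) (hle : ∀ p, m p ≤ 1)
    (hpos : ∀ t, 0 < m (t, 0))
    (hanti : ∀ t x, ∀ τ : ℝ, 0 ≤ τ → τ ≤ 1 → m (t, x) ≤ m (t, τ • x)) :
    TrivialOver V {p : T × V | 0 < m p} := by
  have hc : ∀ (t : T) (y : V), Continuous fun σ : ℝ => m (t, σ • y) := fun t y => by fun_prop
  choose s hs0 hs using fun (p : T × V) => exists_ray_root m p.1 p.2 (hc _ _) hle (hpos _)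
  have hmono : ∀ (t : T) (y : V) (a b : ℝ), 0 ≤ a → a ≤ b → m (t, b • y) ≤ m (t, a • y) := by
    intro t y a b ha hab
    rcases ha.eq_or_lt with rfl | ha
    · have := hanti t (b • y) 0 le_rfl zero_le_one
      simpa using this
    · have hb : 0 < b := ha.trans_le hab
      have := hanti t (b • y) (a / b) (by positivity) (by rw [div_le_one hb]; exact hab)
      rwa [smul_smul, div_mul_cancel₀ _ hb.ne'] at this
  have huniq : ∀ (p : T × V) (a : ℝ), 0 < a → m (p.1, a • p.2) = a → s p = a := by
    intro p a ha h
    rcases le_total a (s p) with h1 | h1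
    · have := hmono p.1 p.2 _ _ ha.le h1
      rw [hs, h] at this; linarith
    · have := hmono p.1 p.2 _ _ (hs0 p).le h1
      rw [hs, h] at this; linarith
  have hscont : Continuous s := by
    rw [continuous_iff_continuousAt]
    intro p
    refine tendsto_order.2 ⟨fun a ha => ?_, fun a ha => ?_⟩
    · rcases lt_or_ge a 0 with h0 | h0
      · exact Eventually.of_forall fun q => h0.trans (hs0 q)
      · have h1 : a < m (p.1, a • p.2) := by
          have := hmono p.1 p.2 _ _ h0 ha.le
          rw [hs] at this; linarith
        have h2 : ContinuousAt (fun q : T × V => m (q.1, a • q.2)) p := by fun_prop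
        filter_upwards [h2.eventually_const_lt h1] with q hq
        by_contra! hcon
        have := hmono q.1 q.2 _ _ (hs0 q).le hcon
        rw [hs] at this; linarith
    · have h1 : m (p.1, a • p.2) < a := by
        have := hmono p.1 p.2 _ _ (hs0 p).le ha.le
        rw [hs] at this; linarith
      have h2 : ContinuousAt (fun q : T × V => m (q.1, a • q.2)) p := by fun_prop
      filter_upwards [h2.eventually_lt_const h1] with q hq
      by_contra! hcon
      have := hmono q.1 q.2 _ _ ((hs0 p).trans ha).le hcon
      rw [hs] at this; linarith
  refine ⟨{ toFun := fun o => (o.1.1, (m o.1)⁻¹ • o.1.2)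
            invFun := fun q => ⟨(q.1, s q • q.2), by simpa [hs] using hs0 q⟩
            left_inv := ?_
            right_inv := ?_
            continuous_toFun := ?_
            continuous_invFun := ?_ }, fun o => rfl⟩
  · rintro ⟨⟨t, x⟩, ho⟩
    have ho' : 0 < m (t, x) := ho
    have := huniq (t, (m (t, x))⁻¹ • x) (m (t, x)) ho'
      (by simp [smul_smul, mul_inv_cancel₀ ho'.ne'])
    simp [this, smul_smul, mul_inv_cancel₀ ho'.ne']
  · rintro ⟨t, y⟩
    have := hs (t, y)
    simp only at this
    simp [this, smul_smul, inv_mul_cancel₀ (hs0 (t, y)).ne']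
  · have : Continuous fun o : {p : T × V | 0 < m p} => (m o.1)⁻¹ :=
      (hm.comp continuous_subtype_val).inv₀ fun o => (o.2 : 0 < m o.1).ne'
    fun_prop
  · fun_prop

end Star

theorem exists_continuous_pos_iff_mem {X : Type*} [TopologicalSpace X]
    [TopologicalSpace.MetrizableSpace X] {O : Set X} (hO : IsOpen O) :
    ∃ φ : X → ℝ, Continuous φ ∧ (∀ x, 0 ≤ φ x) ∧ (∀ x, φ x ≤ 1) ∧ ∀ x, 0 < φ x ↔ x ∈ O := by
  let _ := TopologicalSpace.metrizableSpaceMetric X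
  rcases (Oᶜ).eq_empty_or_nonempty with h | h
  · refine ⟨fun _ => 1, continuous_const, fun _ => zero_le_one, fun _ => le_rfl, fun x => ?_⟩
    rw [compl_empty_iff] at h
    simp [h]
  · refine ⟨fun x => min 1 (Metric.infDist x Oᶜ), by fun_prop, fun x => ?_, fun x => min_le_left _ _,
      fun x => ?_⟩
    · exact le_min zero_le_one Metric.infDist_nonneg
    · rw [lt_min_iff, ← notMem_compl_iff, ← hO.isClosed_compl.notMem_iff_infDist_pos h]
      simp

theorem trivialOver_of_starShaped {T V : Type*} [TopologicalSpace T]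
    [TopologicalSpace.MetrizableSpace T] [AddCommGroup V] [Module ℝ V] [TopologicalSpace V]
    [IsTopologicalAddGroup V] [ContinuousSMul ℝ V] [TopologicalSpace.MetrizableSpace V]
    {O : Set (T × V)} (hO : IsOpen O) {c : T → V} (hc : Continuous c) (hcO : ∀ t, (t, c t) ∈ O)
    (hstar : ∀ t v, (t, v) ∈ O → ∀ τ : ℝ, 0 ≤ τ → τ ≤ 1 → (t, c t + τ • (v - c t)) ∈ O) :
    TrivialOver V O := by
  obtain ⟨φ, hφ, hφ0, hφ1, hφO⟩ := exists_continuous_pos_iff_mem hO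
  let ψ : T × V → ℝ → ℝ := fun p τ => φ (p.1, c p.1 + τ • p.2)
  let m : T × V → ℝ := fun p => sInf (ψ p '' Icc 0 1)
  have hψ : Continuous ↿ψ := by
    change Continuous fun q : (T × V) × ℝ => φ (q.1.1, c q.1.1 + q.2 • q.1.2)
    fun_prop
  have hm : Continuous m := isCompact_Icc.continuous_sInf hψ
  have hbdd : ∀ p, BddBelow (ψ p '' Icc 0 1) := fun p =>
    ⟨0, by rintro _ ⟨τ, -, rfl⟩; exact hφ0 _⟩
  have hmle : ∀ p (τ : ℝ), 0 ≤ τ → τ ≤ 1 → m p ≤ ψ p τ := fun p τ h0 h1 =>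
    csInf_le (hbdd p) ⟨τ, ⟨h0, h1⟩, rfl⟩
  have hmem : ∀ p, ∃ τ ∈ Icc (0 : ℝ) 1, ψ p τ = m p := fun p => by
    have : IsCompact (ψ p '' Icc 0 1) := isCompact_Icc.image (by
      change Continuous fun τ : ℝ => φ (p.1, c p.1 + τ • p.2)
      fun_prop)
    exact this.sInf_mem ((nonempty_Icc.2 zero_le_one).image _)
  have hpos : ∀ p, 0 < m p ↔ (p.1, c p.1 + p.2) ∈ O := by
    intro p
    constructor
    · intro h
      have := h.trans_le (hmle p 1 zero_le_one le_rfl)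
      rw [← hφO]
      simpa [ψ] using this
    · intro h
      obtain ⟨τ, hτ, h'⟩ := hmem p
      rw [← h']
      refine (hφO _).2 ?_
      have := hstar _ _ h τ hτ.1 hτ.2
      simpa using this
  obtain ⟨h, hh⟩ := trivialOver_of_antitone_rays m hm
    (fun p => (hmle p 1 zero_le_one le_rfl).trans (hφ1 _))
    (fun t => by rw [hpos]; simpa using hcO t)
    (fun t x τ h0 h1 => by
      obtain ⟨τ', hτ', h'⟩ := hmem (t, τ • x)
      rw [← h']
      refine (hmle (t, x) (τ' * τ) (mul_nonneg hτ'.1 h0) (mul_le_one₀ hτ'.2 h0 h1)).trans_eq ?_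
      simp [ψ, smul_smul])
  let e : T × V ≃ₜ T × V :=
    { toFun := fun p => (p.1, p.2 - c p.1)
      invFun := fun p => (p.1, c p.1 + p.2)
      left_inv := fun p => by simp
      right_inv := fun p => by simp
      continuous_toFun := by fun_prop
      continuous_invFun := by fun_prop }
  let e' : O ≃ₜ {p : T × V | 0 < m p} := e.subtype (fun p => by
    change p ∈ O ↔ 0 < m (p.1, p.2 - c p.1)
    rw [hpos]; simp)
  exact ⟨e'.trans h, fun o => hh _⟩

/-- Open sets with nonempty convex sections are trivial. -/
theorem trivialOver_of_convex {T V : Type*} [TopologicalSpace T]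
    [TopologicalSpace.MetrizableSpace T] [AddCommGroup V] [Module ℝ V] [TopologicalSpace V]
    [IsTopologicalAddGroup V] [ContinuousSMul ℝ V] [TopologicalSpace.MetrizableSpace V]
    {O : Set (T × V)} (hO : IsOpen O) (hne : ∀ t, ∃ v, (t, v) ∈ O)
    (hconv : ∀ t, Convex ℝ {v | (t, v) ∈ O}) : TrivialOver V O := by
  let _ := TopologicalSpace.metrizableSpaceMetric T
  obtain ⟨c, hc⟩ := exists_continuous_forall_mem_convex_of_local_const (t := fun t => {v | (t, v) ∈ O})
    hconv (fun t => by
      obtain ⟨v, hv⟩ := hne t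
      refine ⟨v, ?_⟩
      have : ContinuousAt (fun y : T => (y, v)) t := by fun_prop
      exact this.eventually_mem (hO.mem_nhds hv))
  refine trivialOver_of_starShaped hO c.continuous hc fun t v hv τ h0 h1 => ?_
  have := (hconv t).add_smul_sub_mem (hc t) hv ⟨h0, h1⟩
  simpa using this

theorem TrivialOver.comp {S R C : Type*} [TopologicalSpace S] [TopologicalSpace R]
    [TopologicalSpace C] {O₁ : Set (S × R)} (h₁ : TrivialOver R O₁) {O₂ : Set (O₁ × C)}
    (h₂ : TrivialOver C O₂) {O : Set (S × (R × C))}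
    (hO : ∀ s r c, (s, (r, c)) ∈ O ↔ ∃ h : (s, r) ∈ O₁, ((⟨(s, r), h⟩ : O₁), c) ∈ O₂) :
    TrivialOver (R × C) O := by
  obtain ⟨e₁, he₁⟩ := h₁
  obtain ⟨e₂, he₂⟩ := h₂
  let e : O ≃ₜ O₂ :=
    { toFun := fun o => ⟨(⟨(o.1.1, o.1.2.1), ((hO _ _ _).1 o.2).1⟩, o.1.2.2), ((hO _ _ _).1 o.2).2⟩
      invFun := fun o => ⟨(o.1.1.1.1, (o.1.1.1.2, o.1.2)), (hO _ _ _).2 ⟨o.1.1.2, o.2⟩⟩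
      left_inv := fun o => rfl
      right_inv := fun o => rfl
      continuous_toFun := by fun_prop
      continuous_invFun := by fun_prop }
  refine ⟨((e.trans e₂).trans (e₁.prodCongr (Homeomorph.refl C))).trans
    (Homeomorph.prodAssoc S R C), fun o => ?_⟩
  change (e₁ (e₂ (e o)).1).1 = _
  rw [he₁, he₂]
  rfl

section Tower

variable {T W : Type*} [TopologicalSpace T] [TopologicalSpace W]

/-- The pairs satisfying the first `n` conditions of a tower of conditions. -/
def towerStage (Q : ℕ → T → (ℕ → W) → Prop) (n : ℕ) : Set (T × (ℕ → W)) :=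
  {p | ∀ k < n, Q k p.1 p.2}

/-- The possible values of the `n`-th coordinate over the `n`-th stage of a tower. -/
def towerFibre (Q : ℕ → T → (ℕ → W) → Prop) (n : ℕ) : Set (towerStage Q n × W) :=
  {p | Q n p.1.1.1 (Function.update p.1.1.2 n p.2)}

theorem trivialOver_tower [Inhabited W] {Q : ℕ → T → (ℕ → W) → Prop}
    (hQ : ∀ n t w w', (∀ k ≤ n, w k = w' k) → Q n t w → Q n t w')
    (htriv : ∀ n, TrivialOver W (towerFibre Q n)) :
    TrivialOver (ℕ → W) {p : T × (ℕ → W) | ∀ n, Q n p.1 p.2} := by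
  classical
  choose h hh using htriv
  let tr : ℕ → (ℕ → W) → (ℕ → W) := fun n w k => if k < n then w k else default
  have htrc : ∀ n, Continuous (tr n) := fun n => continuous_pi fun k => by
    by_cases hk : k < n <;> simp only [tr, hk, if_true, if_false] <;> fun_prop
  have hsymm : ∀ n σ v, ((h n).symm (σ, v)).1.1 = σ := fun n σ v => by
    rw [← hh, Homeomorph.apply_symm_apply]
  let step : ∀ n, C(towerStage Q n × W, towerStage Q (n + 1)) := fun n =>
    { toFun := fun p => ⟨(p.1.1.1, Function.update p.1.1.2 n ((h n).symm p).1.2), by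
        intro k hk
        rcases Nat.lt_succ_iff_lt_or_eq.1 hk with hk | rfl
        · refine hQ k _ _ _ (fun j hj => ?_) (p.1.2 k hk)
          exact (Function.update_of_ne (by omega) _ _).symm
        · have := ((h k).symm p).2
          change Q k _ (Function.update _ k _) at this
          rwa [hsymm] at this⟩
      continuous_toFun := by
        refine Continuous.subtype_mk (Continuous.prodMk (by fun_prop) ?_) _
        exact Continuous.update (by fun_prop) n (by fun_prop) }
  let G : ∀ n, C(T × (ℕ → W), towerStage Q n) := fun n =>
    Nat.rec (motive := fun n => C(T × (ℕ → W), towerStage Q n))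
      { toFun := fun p => ⟨(p.1, fun _ => default), fun k hk => absurd hk (Nat.not_lt_zero k)⟩
        continuous_toFun := by fun_prop }
      (fun n g => (step n).comp (g.prodMk
        { toFun := fun p => p.2 n, continuous_toFun := by fun_prop })) n
  have hG1 : ∀ n p, ((G n p).1).1 = p.1 := by
    intro n p
    induction n with
    | zero => rfl
    | succ n ih => exact ih
  let lim : T × (ℕ → W) → ℕ → W := fun p n => ((h n).symm (G n p, p.2 n)).1.2
  have hGsucc : ∀ n p, (G (n + 1) p).1.2 = Function.update (G n p).1.2 n (lim p n) :=
    fun n p => rfl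
  have hG2 : ∀ n p, (G n p).1.2 = tr n (lim p) := by
    intro n p
    induction n with
    | zero => ext k; simp [tr, G]
    | succ n ih =>
      rw [hGsucc, ih]
      ext k
      rcases lt_trichotomy k n with hk | rfl | hk
      · rw [Function.update_of_ne hk.ne]; simp [tr, hk, hk.trans (Nat.lt_succ_self n)]
      · simp [tr]
      · rw [Function.update_of_ne hk.ne']
        simp [tr, show ¬ k < n by omega, show ¬ k < n + 1 by omega]
  have hG : ∀ n p, (G n p).1 = (p.1, tr n (lim p)) := fun n p => Prod.ext (hG1 n p) (hG2 n p)
  have hlimQ : ∀ p n, Q n p.1 (lim p) := by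
    intro p n
    have := (G (n + 1) p).2 n (Nat.lt_succ_self n)
    rw [hG (n + 1) p] at this
    exact hQ n _ _ _ (fun k hk => by simp [tr, show k < n + 1 by omega]) this
  have hstage : ∀ (p : T × (ℕ → W)), (∀ n, Q n p.1 p.2) → ∀ n,
      (p.1, tr n p.2) ∈ towerStage Q n := fun p hp n k hk =>
    hQ k _ _ _ (fun j hj => by simp [tr, show j < n by omega]) (hp k)
  have hfib : ∀ (p : T × (ℕ → W)) (hp : ∀ n, Q n p.1 p.2) (n),
      ((⟨(p.1, tr n p.2), hstage p hp n⟩ : towerStage Q n), p.2 n) ∈ towerFibre Q n :=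
    fun p hp n => hQ n _ _ _ (fun k hk => by
      rcases hk.lt_or_eq with hk | rfl
      · rw [Function.update_of_ne hk.ne]; simp [tr, hk]
      · simp) (hp n)
  let F : {p : T × (ℕ → W) | ∀ n, Q n p.1 p.2} → ℕ → W := fun p n =>
    (h n ⟨(⟨(p.1.1, tr n p.1.2), hstage p.1 p.2 n⟩, p.1.2 n), hfib p.1 p.2 n⟩).2
  refine ⟨{ toFun := fun p => (p.1.1, F p)
            invFun := fun p => ⟨(p.1, lim p), hlimQ p⟩
            left_inv := ?_
            right_inv := ?_
            continuous_toFun := ?_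
            continuous_invFun := ?_ }, fun _ => rfl⟩
  · rintro ⟨⟨t, w⟩, hw⟩
    have key : ∀ n, (G n (t, F ⟨(t, w), hw⟩)).1 = (t, tr n w) := by
      intro n
      induction n with
      | zero => ext k <;> simp [tr, G]
      | succ n ih =>
        refine Prod.ext (hG1 _ _) ?_
        rw [hGsucc, ih]
        have : lim (t, F ⟨(t, w), hw⟩) n = w n := by
          have e : (G n (t, F ⟨(t, w), hw⟩), F ⟨(t, w), hw⟩ n) =
              h n ⟨(⟨(t, tr n w), hstage _ hw n⟩, w n), hfib _ hw n⟩ := by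
            refine Prod.ext ?_ rfl
            rw [hh]
            exact Subtype.ext ih
          simp only [lim]
          rw [e, Homeomorph.symm_apply_apply]
        rw [this]
        ext k
        rcases lt_trichotomy k n with hk | rfl | hk
        · rw [Function.update_of_ne hk.ne]; simp [tr, hk, hk.trans (Nat.lt_succ_self n)]
        · simp [tr]
        · rw [Function.update_of_ne hk.ne']
          simp [tr, show ¬ k < n by omega, show ¬ k < n + 1 by omega]
    refine Subtype.ext (Prod.ext rfl (funext fun n => ?_))
    have h1 := key (n + 1)
    rw [hG (n + 1) (t, F ⟨(t, w), hw⟩)] at h1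
    have h2 := congrFun (Prod.ext_iff.1 h1).2 n
    simpa [tr] using h2
  · rintro ⟨t, y⟩
    refine Prod.ext rfl (funext fun n => ?_)
    have e : (⟨(⟨(t, tr n (lim (t, y))), hstage (t, lim (t, y)) (hlimQ (t, y)) n⟩,
        lim (t, y) n), hfib (t, lim (t, y)) (hlimQ (t, y)) n⟩ : towerFibre Q n) = (h n).symm (G n (t, y), y n) := by
      refine Subtype.ext (Prod.ext ?_ rfl)
      rw [hsymm]
      exact Subtype.ext (hG n (t, y)).symm
    simp only [F]
    rw [e, Homeomorph.apply_symm_apply]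
  · refine Continuous.prodMk (by fun_prop) (continuous_pi fun n => ?_)
    refine continuous_snd.comp ((h n).continuous.comp (Continuous.subtype_mk ?_ _))
    exact Continuous.prodMk (Continuous.subtype_mk (by fun_prop) _) (by fun_prop)
  · refine Continuous.subtype_mk (Continuous.prodMk (by fun_prop) (continuous_pi fun n => ?_)) _
    exact continuous_snd.comp (continuous_subtype_val.comp ((h n).symm.continuous.comp
      ((G n).continuous.prodMk (by fun_prop))))

end Tower

theorem metrizableSpace_nat_pi (W : Type*) [TopologicalSpace W]
    [TopologicalSpace.MetrizableSpace W] : TopologicalSpace.MetrizableSpace (ℕ → W) := by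
  let _ := TopologicalSpace.metrizableSpaceMetric W
  infer_instance

/-- The data from which a space over `B` is shown to be absorbed by its base. -/
structure AbsorptionData (X B C : Type) [MetricSpace X] [TopologicalSpace B] [TopologicalSpace C]
    where
  /-- the projection -/
  p : X → B
  continuous_p : Continuous p
  /-- the domain of the parametrization -/
  D : Set (B × C)
  isOpen_D : IsOpen D
  /-- the parametrization of a dense part of each fibre -/
  r : B × C → X
  continuousOn_r : ContinuousOn r D
  p_r : ∀ q ∈ D, p (r q) = q.1
  exists_mem_D : ∀ b, ∃ c, (b, c) ∈ D
  dense_r : ∀ x ε, 0 < ε → ∃ c, (p x, c) ∈ D ∧ dist (r (p x, c)) x < ε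
  /-- the admissible functions -/
  Adm : B → (X → ℝ) → Prop
  adm_const : ∀ b a, Adm b fun _ => a
  adm_dist : ∀ y, Adm (p y) fun x => dist x y
  adm_max : ∀ b f g, Adm b f → Adm b g → Adm b fun x => max (f x) (g x)
  adm_add : ∀ b f a, Adm b f → Adm b fun x => f x + a
  trivial_sublevel : ∀ (S : Type) [TopologicalSpace S] [TopologicalSpace.MetrizableSpace S]
    (β : S → B), Continuous β → ∀ f : S → X → ℝ, Continuous (fun q : S × X => f q.1 q.2) →
    (∀ s, Adm (β s) (f s)) → (∀ s, ∃ c, (β s, c) ∈ D ∧ f s (r (β s, c)) < 0) →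
    TrivialOver C {q : S × C | (β q.1, q.2) ∈ D ∧ f q.1 (r (β q.1, q.2)) < 0}

namespace AbsorptionData

variable {X B C : Type} [MetricSpace X] [TopologicalSpace B] [TopologicalSpace C]
  (d : AbsorptionData X B C)

theorem isOpen_sublevel {S : Type} [TopologicalSpace S] {β : S → B} (hβ : Continuous β)
    {f : S → X → ℝ} (hf : Continuous fun q : S × X => f q.1 q.2) {κ : S × C → ℝ}
    (hκ : Continuous κ) :
    IsOpen {q : S × C | (β q.1, q.2) ∈ d.D ∧ f q.1 (d.r (β q.1, q.2)) + κ q < 0} := by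
  have hβ' : Continuous fun q : S × C => (β q.1, q.2) := by fun_prop
  have hD : IsOpen ((fun q : S × C => (β q.1, q.2)) ⁻¹' d.D) := d.isOpen_D.preimage hβ'
  have hc : ContinuousOn (fun q : S × C => f q.1 (d.r (β q.1, q.2)) + κ q)
      ((fun q : S × C => (β q.1, q.2)) ⁻¹' d.D) := by
    refine ContinuousOn.add (hf.comp_continuousOn (continuousOn_fst.prodMk ?_)) hκ.continuousOn
    exact d.continuousOn_r.comp hβ'.continuousOn fun q hq => hq
  exact hc.isOpen_inter_preimage hD isOpen_Iio

theorem trivialOver_stage [TopologicalSpace.MetrizableSpace C]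
    {S : Type} [TopologicalSpace S] [TopologicalSpace.MetrizableSpace S] {β : S → B}
    (hβ : Continuous β) {f f' : S → X → ℝ} (hf : Continuous fun q : S × X => f q.1 q.2)
    (hf' : Continuous fun q : S × X => f' q.1 q.2) (ha : ∀ s, d.Adm (β s) (f s))
    (ha' : ∀ s, d.Adm (β s) (f' s)) {I : Set (S × ℝ)} (hI : IsOpen I)
    (hIc : ∀ s, Convex ℝ {a | (s, a) ∈ I})
    (hne : ∀ s, ∃ a c, (s, a) ∈ I ∧ (β s, c) ∈ d.D ∧ f s (d.r (β s, c)) + a < 0 ∧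
      f' s (d.r (β s, c)) < 0) :
    TrivialOver (ℝ × C) {q : S × (ℝ × C) | (q.1, q.2.1) ∈ I ∧ (β q.1, q.2.2) ∈ d.D ∧
      f q.1 (d.r (β q.1, q.2.2)) + q.2.1 < 0 ∧ f' q.1 (d.r (β q.1, q.2.2)) < 0} := by
  let O₁ : Set (S × ℝ) := {q | q ∈ I ∧ ∃ c, (β q.1, c) ∈ d.D ∧
      f q.1 (d.r (β q.1, c)) + q.2 < 0 ∧ f' q.1 (d.r (β q.1, c)) < 0}
  have hO₁ : IsOpen O₁ := by
    have h1 := d.isOpen_sublevel (S := S × ℝ) (β := fun q => β q.1) (by fun_prop)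
      (f := fun q x => f q.1 x)
      (hf.comp (by fun_prop : Continuous fun q : (S × ℝ) × X => (q.1.1, q.2)))
      (κ := fun q => q.1.2) (by fun_prop)
    have h2 := d.isOpen_sublevel (S := S × ℝ) (β := fun q => β q.1) (by fun_prop)
      (f := fun q x => f' q.1 x)
      (hf'.comp (by fun_prop : Continuous fun q : (S × ℝ) × X => (q.1.1, q.2)))
      (κ := fun q => 0) (by fun_prop)
    convert hI.inter (isOpenMap_fst _ (h1.inter h2)) using 1
    ext q
    constructor
    · rintro ⟨hq, c, h, h', h''⟩
      exact ⟨hq, (q, c), ⟨⟨h, h'⟩, h, by simpa using h''⟩, rfl⟩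
    · rintro ⟨hq, ⟨q, c⟩, ⟨⟨h, h'⟩, -, h''⟩, rfl⟩
      exact ⟨hq, c, h, h', by simpa using h''⟩
  have ht₁ : TrivialOver ℝ O₁ := by
    refine trivialOver_of_convex hO₁ (fun s => ?_) fun s => ?_
    · obtain ⟨a, c, h1, h2⟩ := hne s
      exact ⟨a, h1, c, h2⟩
    · refine OrdConnected.convex ⟨?_⟩
      rintro a ⟨ha, -⟩ b ⟨hb, c, h1, h2, h3⟩ e he
      refine ⟨(hIc s).ordConnected.out ha hb he, c, h1, ?_, h3⟩
      simp only at h2 ⊢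
      linarith [he.2]
  have ht₂ := d.trivial_sublevel O₁ (fun o => β o.1.1) (by fun_prop)
    (fun o x => max (f o.1.1 x + o.1.2) (f' o.1.1 x))
    (by
      have h1 : Continuous fun q : O₁ × X => f q.1.1.1 q.2 :=
        hf.comp (by fun_prop : Continuous fun q : O₁ × X => (q.1.1.1, q.2))
      have h2 : Continuous fun q : O₁ × X => f' q.1.1.1 q.2 :=
        hf'.comp (by fun_prop : Continuous fun q : O₁ × X => (q.1.1.1, q.2))
      fun_prop)
    (fun o => d.adm_max _ _ _ (d.adm_add _ _ _ (ha _)) (ha' _))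
    (fun o => by
      obtain ⟨-, c, h1, h2, h3⟩ := o.2
      exact ⟨c, h1, max_lt h2 h3⟩)
  refine ht₁.comp ht₂ fun s a c => ?_
  constructor
  · rintro ⟨h1, h2, h3, h4⟩
    exact ⟨⟨h1, c, h2, h3, h4⟩, h2, max_lt h3 h4⟩
  · rintro ⟨⟨h1, _⟩, h2, h3⟩
    rw [max_lt_iff] at h3
    exact ⟨h1, h2, h3.1, h3.2⟩

/-- The functions recording the constraints imposed by a sequence of codes. -/
noncomputable def gauge : ℕ → B → (ℕ → ℝ × C) → X → ℝ
  | 0, _, _, _ => -1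
  | n + 1, b, w, x => max (gauge n b w x + (w n).1) (dist x (d.r (b, (w n).2)) - (1 / 2) ^ n)

theorem gauge_congr {n : ℕ} {b : B} {w w' : ℕ → ℝ × C} (h : ∀ k < n, w k = w' k) (x : X) :
    d.gauge n b w x = d.gauge n b w' x := by
  induction n with
  | zero => rfl
  | succ n ih =>
    simp only [gauge]
    rw [ih fun k hk => h k (hk.trans (Nat.lt_succ_self n)), h n (Nat.lt_succ_self n)]

theorem adm_gauge {n : ℕ} {b : B} {w : ℕ → ℝ × C} (h : ∀ k < n, (b, (w k).2) ∈ d.D) :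
    d.Adm b (d.gauge n b w) := by
  induction n with
  | zero => exact d.adm_const _ _
  | succ n ih =>
    refine d.adm_max _ _ _ (d.adm_add _ _ _ (ih fun k hk => h k (hk.trans (Nat.lt_succ_self n)))) ?_
    simp only [sub_eq_add_neg]
    refine d.adm_add _ _ _ ?_
    have := d.adm_dist (d.r (b, (w n).2))
    rwa [d.p_r _ (h n (Nat.lt_succ_self n))] at this

theorem continuous_gauge {S : Type} [TopologicalSpace S] {β : S → B} (hβ : Continuous β)
    {w : S → ℕ → ℝ × C} (hw : Continuous w) (n : ℕ)
    (h : ∀ s, ∀ k < n, (β s, (w s k).2) ∈ d.D) :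
    Continuous fun q : S × X => d.gauge n (β q.1) (w q.1) q.2 := by
  induction n with
  | zero => exact continuous_const
  | succ n ih =>
    have h1 := ih fun s k hk => h s k (hk.trans (Nat.lt_succ_self n))
    have h2 : Continuous fun s => d.r (β s, (w s n).2) :=
      d.continuousOn_r.comp_continuous (by fun_prop) fun s => h s n (Nat.lt_succ_self n)
    have h3 : Continuous fun s => (w s n).1 := by fun_prop
    have h4 : Continuous fun q : S × X => d.r (β q.1, (w q.1 n).2) := h2.comp continuous_fst
    exact (h1.add (h3.comp continuous_fst)).max ((continuous_snd.dist h4).sub continuous_const)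

/-- The `n`-th condition on codes over the base. -/
def BaseCond (n : ℕ) (b : B) (w : ℕ → ℝ × C) : Prop :=
  0 < (w n).1 ∧ (b, (w n).2) ∈ d.D ∧ d.gauge n b w (d.r (b, (w n).2)) + (w n).1 < 0

/-- The `n`-th condition on codes over the total space. -/
def TotalCond (n : ℕ) (x : X) (w : ℕ → ℝ × C) : Prop :=
  d.BaseCond n (d.p x) w ∧ d.gauge n (d.p x) w x + (w n).1 < 0 ∧
    dist (d.r (d.p x, (w n).2)) x - (1 / 2) ^ n < 0

theorem baseCond_congr {n : ℕ} {b : B} {w w' : ℕ → ℝ × C} (h : ∀ k ≤ n, w k = w' k)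
    (hw : d.BaseCond n b w) : d.BaseCond n b w' := by
  have h1 := fun x => d.gauge_congr (b := b) (fun k hk => h k (le_of_lt hk)) x
  have h2 := h n le_rfl
  unfold BaseCond at *
  rw [← h2, ← h1]
  exact hw

theorem totalCond_congr {n : ℕ} {x : X} {w w' : ℕ → ℝ × C} (h : ∀ k ≤ n, w k = w' k)
    (hw : d.TotalCond n x w) : d.TotalCond n x w' := by
  have h1 := fun y => d.gauge_congr (b := d.p x) (fun k hk => h k (le_of_lt hk)) y
  have h2 := h n le_rfl
  refine ⟨d.baseCond_congr h hw.1, ?_⟩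
  rw [← h2, ← h1]
  exact hw.2

theorem exists_gauge_neg {n : ℕ} {b : B} {w : ℕ → ℝ × C} (h : ∀ k < n, d.BaseCond k b w) :
    ∃ c, (b, c) ∈ d.D ∧ d.gauge n b w (d.r (b, c)) < 0 := by
  rcases n with _ | n
  · obtain ⟨c, hc⟩ := d.exists_mem_D b
    exact ⟨c, hc, by norm_num [gauge]⟩
  · obtain ⟨h1, h2, h3⟩ := h n (Nat.lt_succ_self n)
    refine ⟨(w n).2, h2, ?_⟩
    simp only [gauge, dist_self]
    exact max_lt h3 (by simp)

theorem gauge_neg {n : ℕ} {x : X} {w : ℕ → ℝ × C} (h : ∀ k < n, d.TotalCond k x w) :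
    d.gauge n (d.p x) w x < 0 := by
  rcases n with _ | n
  · norm_num [gauge]
  · obtain ⟨h1, h2, h3⟩ := h n (Nat.lt_succ_self n)
    simp only [gauge]
    rw [dist_comm]
    exact max_lt h2 h3

section

variable [TopologicalSpace.MetrizableSpace C]

theorem trivialOver_base [TopologicalSpace.MetrizableSpace B] [Inhabited C] :
    TrivialOver (ℕ → ℝ × C) {q : B × (ℕ → ℝ × C) | ∀ n, d.BaseCond n q.1 q.2} := by
  have := metrizableSpace_nat_pi (ℝ × C)
  refine trivialOver_tower (fun n b w w' h => d.baseCond_congr h) fun n => ?_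
  have hcond : ∀ (σ : towerStage d.BaseCond n), ∀ k < n, (σ.1.1, (σ.1.2 k).2) ∈ d.D :=
    fun σ k hk => (σ.2 k hk).2.1
  have := d.trivialOver_stage (S := towerStage d.BaseCond n) (β := fun σ => σ.1.1) (by fun_prop)
    (f := fun σ => d.gauge n σ.1.1 σ.1.2) (f' := fun _ _ => -1)
    (d.continuous_gauge (by fun_prop) (by fun_prop) n hcond) (by fun_prop)
    (fun σ => d.adm_gauge (hcond σ)) (fun σ => d.adm_const _ _)
    (I := {q | 0 < q.2}) (isOpen_lt (by fun_prop) (by fun_prop)) (fun σ => convex_Ioi 0)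
    (fun σ => by
      obtain ⟨c, h1, h2⟩ := d.exists_gauge_neg σ.2
      refine ⟨-(d.gauge n σ.1.1 σ.1.2 (d.r (σ.1.1, c))) / 2, c, ?_, h1, ?_, by norm_num⟩
      · simp only [mem_ofPred_eq]; linarith
      · linarith)
  convert this using 1
  ext ⟨σ, a, c⟩
  have hg := fun x => d.gauge_congr (b := σ.1.1) (n := n) (w := Function.update σ.1.2 n (a, c))
    (w' := σ.1.2) (fun k hk => Function.update_of_ne hk.ne _ _) x
  simp [towerFibre, BaseCond, hg]

theorem trivialOver_total [Inhabited C] :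
    TrivialOver (ℕ → ℝ × C) {q : X × (ℕ → ℝ × C) | ∀ n, d.TotalCond n q.1 q.2} := by
  have := metrizableSpace_nat_pi (ℝ × C)
  refine trivialOver_tower (fun n b w w' h => d.totalCond_congr h) fun n => ?_
  have hp := d.continuous_p
  have hcond : ∀ (σ : towerStage d.TotalCond n), ∀ k < n, (d.p σ.1.1, (σ.1.2 k).2) ∈ d.D :=
    fun σ k hk => (σ.2 k hk).1.2.1
  have hgc := d.continuous_gauge (S := towerStage d.TotalCond n) (β := fun σ => d.p σ.1.1)
    (w := fun σ => σ.1.2) (by fun_prop) (by fun_prop) n hcond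
  have hgx : Continuous fun σ : towerStage d.TotalCond n => d.gauge n (d.p σ.1.1) σ.1.2 σ.1.1 :=
    hgc.comp (by fun_prop : Continuous fun σ : towerStage d.TotalCond n => (σ, σ.1.1))
  have := d.trivialOver_stage (S := towerStage d.TotalCond n) (β := fun σ => d.p σ.1.1)
    (by fun_prop)
    (f := fun σ => d.gauge n (d.p σ.1.1) σ.1.2) (f' := fun σ y => dist y σ.1.1 + -(1 / 2) ^ n)
    hgc (by fun_prop)
    (fun σ => d.adm_gauge (hcond σ)) (fun σ => d.adm_add _ _ _ (d.adm_dist _))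
    (I := {q | 0 < q.2 ∧ d.gauge n (d.p q.1.1.1) q.1.1.2 q.1.1.1 + q.2 < 0})
    ((isOpen_lt continuous_const continuous_snd).and
      (isOpen_lt ((hgx.comp continuous_fst).add continuous_snd) continuous_const))
    (fun σ => OrdConnected.convex ⟨by
      rintro a ⟨ha, -⟩ b ⟨-, hb⟩ e he
      refine ⟨?_, ?_⟩
      · simp only at ha ⊢
        linarith [he.1]
      · simp only at hb ⊢
        linarith [he.2]⟩)
    (fun σ => by
      have hneg := d.gauge_neg σ.2
      have hcx : Continuous fun y : X => d.gauge n (d.p σ.1.1) σ.1.2 y :=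
        hgc.comp (by fun_prop : Continuous fun y : X => (σ, y))
      set g := d.gauge n (d.p σ.1.1) σ.1.2 σ.1.1 with hg
      have hev := (hcx.tendsto σ.1.1).eventually_lt_const (show _ < g / 2 by rw [← hg]; linarith)
      obtain ⟨ε, hε, hball⟩ := Metric.eventually_nhds_iff.1 hev
      obtain ⟨c, hc, hcd⟩ := d.dense_r σ.1.1 (min ε ((1 / 2) ^ n)) (lt_min hε (by positivity))
      refine ⟨-g / 2, c, ⟨?_, ?_⟩, hc, ?_, ?_⟩
      · simp only; linarith
      · simp only; linarith
      · linarith [hball (hcd.trans_le (min_le_left _ _))]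
      · linarith [hcd.trans_le (min_le_right _ _)])
  convert this using 1
  ext ⟨σ, a, c⟩
  have hg := fun x => d.gauge_congr (b := d.p σ.1.1) (n := n)
    (w := Function.update σ.1.2 n (a, c)) (w' := σ.1.2)
    (fun k hk => Function.update_of_ne hk.ne _ _) x
  simp only [towerFibre, TotalCond, BaseCond, hg, mem_ofPred_eq, Function.update_self,
    sub_eq_add_neg]
  tauto

end

theorem gauge_mono {b : B} {w : ℕ → ℝ × C} (h : ∀ n, 0 < (w n).1) (x : X) :
    Monotone fun n => d.gauge n b w x :=
  monotone_nat_of_le_succ fun n => by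
    simp only [gauge]
    exact le_max_of_le_left (by linarith [h n])

theorem dist_r_le {b : B} {w : ℕ → ℝ × C} (h : ∀ n, d.BaseCond n b w) {n m : ℕ} (hnm : n ≤ m) :
    dist (d.r (b, (w m).2)) (d.r (b, (w n).2)) ≤ (1 / 2) ^ n := by
  rcases hnm.eq_or_lt with rfl | hlt
  · simp
  · have h1 := d.gauge_mono (b := b) (fun n => (h n).1) (d.r (b, (w m).2)) (Nat.succ_le_of_lt hlt)
    have h2 : d.gauge (n + 1) b w (d.r (b, (w m).2)) < 0 := by
      have := (h m).2.2
      have := (h m).1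
      simp only [Nat.succ_eq_add_one] at h1
      linarith
    simp only [gauge, max_lt_iff] at h2
    linarith [h2.2]

theorem exists_lim [CompleteSpace X] {b : B} {w : ℕ → ℝ × C} (h : ∀ n, d.BaseCond n b w) :
    ∃ x, Tendsto (fun n => d.r (b, (w n).2)) atTop (𝓝 x) := by
  refine cauchySeq_tendsto_of_complete
    (cauchySeq_of_le_tendsto_0 (fun n => 2 * (1 / 2 : ℝ) ^ n) (fun n m N hn hm => ?_) ?_)
  · have h1 := d.dist_r_le h hn
    have h2 := d.dist_r_le h hm
    have := dist_triangle_right (d.r (b, (w n).2)) (d.r (b, (w m).2)) (d.r (b, (w N).2))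
    linarith
  · simpa using (tendsto_pow_atTop_nhds_zero_of_lt_one (r := (1 / 2 : ℝ)) (by norm_num)
      (by norm_num)).const_mul 2

theorem totalCond_lim [T2Space B] {b : B} {w : ℕ → ℝ × C} (h : ∀ n, d.BaseCond n b w) {x : X}
    (hx : Tendsto (fun n => d.r (b, (w n).2)) atTop (𝓝 x)) :
    d.p x = b ∧ ∀ n, d.TotalCond n x w := by
  have hp : d.p x = b := by
    have h1 := (d.continuous_p.tendsto x).comp hx
    refine tendsto_nhds_unique h1 (tendsto_const_nhds.congr fun n => ?_)
    exact (d.p_r _ (h n).2.1).symm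
  have hle : ∀ n, d.gauge n b w x ≤ 0 := fun n => by
    have hc : Continuous fun y : X => d.gauge n b w y :=
      (d.continuous_gauge (S := Unit) (β := fun _ => b) (w := fun _ => w) continuous_const
        continuous_const n fun _ k _ => (h k).2.1).comp
        (by fun_prop : Continuous fun y : X => ((), y))
    refine le_of_tendsto ((hc.tendsto x).comp hx) ?_
    filter_upwards [eventually_ge_atTop n] with m hm
    have h1 := d.gauge_mono (b := b) (fun n => (h n).1) (d.r (b, (w m).2)) hm
    have h2 := (h m).2.2
    have h3 := (h m).1
    simp only [Function.comp] at h1 ⊢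
    linarith
  have hlt : ∀ n, d.gauge n b w x < 0 := fun n => by
    have h1 := hle (n + 1)
    simp only [gauge, max_le_iff] at h1
    linarith [(h n).1]
  refine ⟨hp, fun n => ?_⟩
  have h1 := hlt (n + 1)
  simp only [gauge, max_lt_iff] at h1
  rw [TotalCond, hp, dist_comm]
  exact ⟨h n, h1⟩

theorem tendsto_of_totalCond {x : X} {w : ℕ → ℝ × C} (h : ∀ n, d.TotalCond n x w) :
    Tendsto (fun n => d.r (d.p x, (w n).2)) atTop (𝓝 x) := by
  rw [tendsto_iff_dist_tendsto_zero]
  refine squeeze_zero (fun n => dist_nonneg) (fun n => (sub_neg.1 (h n).2.2).le) ?_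
  exact tendsto_pow_atTop_nhds_zero_of_lt_one (by norm_num) (by norm_num)

theorem exists_homeomorph_cond [CompleteSpace X] [T2Space B] :
    ∃ h : {q : X × (ℕ → ℝ × C) | ∀ n, d.TotalCond n q.1 q.2} ≃ₜ
      {q : B × (ℕ → ℝ × C) | ∀ n, d.BaseCond n q.1 q.2}, ∀ q, (h q).1.1 = d.p q.1.1 := by
  choose l hl using fun q : {q : B × (ℕ → ℝ × C) | ∀ n, d.BaseCond n q.1 q.2} => d.exists_lim q.2
  have hlc : Continuous l := by
    have hu : TendstoUniformly (fun (n : ℕ) (q : {q : B × (ℕ → ℝ × C) |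
        ∀ n, d.BaseCond n q.1 q.2}) => d.r (q.1.1, (q.1.2 n).2)) l atTop := by
      rw [Metric.tendstoUniformly_iff]
      intro ε hε
      have := (tendsto_pow_atTop_nhds_zero_of_lt_one (r := (1 / 2 : ℝ)) (by norm_num)
        (by norm_num)).eventually_lt_const hε
      filter_upwards [this] with n hn q
      refine lt_of_le_of_lt ?_ hn
      refine le_of_tendsto ((hl q).dist tendsto_const_nhds) ?_
      filter_upwards [eventually_ge_atTop n] with m hm
      exact d.dist_r_le q.2 hm
    refine hu.continuous (Frequently.of_forall fun n => ?_)
    exact d.continuousOn_r.comp_continuous (by fun_prop) fun q => (q.2 n).2.1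
  have hp := d.continuous_p
  refine ⟨{ toFun := fun q => ⟨(d.p q.1.1, q.1.2), fun n => (q.2 n).1⟩
            invFun := fun q => ⟨(l q, q.1.2), (d.totalCond_lim q.2 (hl q)).2⟩
            left_inv := fun q => Subtype.ext (Prod.ext
              (tendsto_nhds_unique (hl _) (d.tendsto_of_totalCond q.2)) rfl)
            right_inv := fun q => Subtype.ext (Prod.ext (d.totalCond_lim q.2 (hl q)).1 rfl)
            continuous_toFun := by fun_prop
            continuous_invFun := by fun_prop }, fun _ => rfl⟩

theorem exists_homeomorph [CompleteSpace X] [TopologicalSpace.MetrizableSpace C]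
    [TopologicalSpace.MetrizableSpace B] [Inhabited C] :
    ∃ h : X × (ℕ → ℝ × C) ≃ₜ B × (ℕ → ℝ × C), ∀ q, (h q).1 = d.p q.1 := by
  obtain ⟨h₁, hh₁⟩ := d.trivialOver_total
  obtain ⟨h₂, hh₂⟩ := d.exists_homeomorph_cond
  obtain ⟨h₃, hh₃⟩ := d.trivialOver_base
  refine ⟨(h₁.symm.trans h₂).trans h₃, fun q => ?_⟩
  simp only [Homeomorph.trans_apply, hh₃, hh₂]
  rw [← hh₁, Homeomorph.apply_symm_apply]

end AbsorptionData

/-- The space of summable real sequences. -/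
abbrev ellOne := lp (fun _ : ℕ => ℝ) 1

/-- A continuous cutoff, vanishing for `N + 1 ≤ k` and equal to one for `k ≤ N`. -/
noncomputable def cutoff (k : ℕ) (N : ℝ) : ℝ := max 0 (min 1 (N + 1 - k))

theorem continuous_cutoff (k : ℕ) : Continuous (cutoff k) := by unfold cutoff; fun_prop

theorem cutoff_nonneg (k : ℕ) (N : ℝ) : 0 ≤ cutoff k N := le_max_left _ _

theorem cutoff_mono (k : ℕ) : Monotone (cutoff k) := fun a b h => by
  unfold cutoff; gcongr

theorem cutoff_eq_zero {k : ℕ} {N : ℝ} (h : N + 1 ≤ k) : cutoff k N = 0 :=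
  max_eq_left ((min_le_right _ _).trans (by linarith))

theorem cutoff_eq_one {k : ℕ} {N : ℝ} (h : (k : ℝ) ≤ N) : cutoff k N = 1 := by
  unfold cutoff
  rw [min_eq_left (by linarith), max_eq_right zero_le_one]

/-- The finitely supported sequences, parametrized by a bound and the values. -/
noncomputable def finSeq (q : ℝ × (ℕ → ℝ)) : ellOne :=
  ∑ k ∈ Finset.range (⌈q.1⌉₊ + 1), lp.single 1 k (cutoff k q.1 * q.2 k)

theorem finSeq_eq_sum {q : ℝ × (ℕ → ℝ)} {M : ℕ} (h : q.1 + 1 ≤ M) :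
    finSeq q = ∑ k ∈ Finset.range M, lp.single 1 k (cutoff k q.1 * q.2 k) := by
  have key : ∀ A B : ℕ, q.1 + 1 ≤ A → A ≤ B →
      ∑ k ∈ Finset.range A, lp.single (E := fun _ : ℕ => ℝ) 1 k (cutoff k q.1 * q.2 k) =
      ∑ k ∈ Finset.range B, lp.single 1 k (cutoff k q.1 * q.2 k) := by
    intro A B hA hAB
    refine Finset.sum_subset (Finset.range_mono hAB) fun k _ hk => ?_
    have : A ≤ k := by simpa using hk
    rw [cutoff_eq_zero (hA.trans (by exact_mod_cast this)), zero_mul, lp.single_zero]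
  have h0 : q.1 + 1 ≤ ((⌈q.1⌉₊ + 1 : ℕ) : ℝ) := by
    push_cast; linarith [Nat.le_ceil q.1]
  rcases le_total M (⌈q.1⌉₊ + 1) with h1 | h1
  · exact (key _ _ h h1).symm
  · exact key _ _ h0 h1

theorem continuous_finSeq : Continuous finSeq := by
  rw [continuous_iff_continuousAt]
  rintro ⟨N, z⟩
  obtain ⟨M, hM⟩ := exists_nat_gt (N + 1)
  have h1 : ∀ᶠ q : ℝ × (ℕ → ℝ) in 𝓝 (N, z), q.1 + 1 < M :=
    (by fun_prop : Continuous fun q : ℝ × (ℕ → ℝ) => q.1 + 1).continuousAt.eventually_lt_const hM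
  refine ContinuousAt.congr ?_ (h1.mono fun q hq => (finSeq_eq_sum hq.le).symm)
  refine Continuous.continuousAt (continuous_finsetSum _ fun k _ => ?_)
  have h2 : Continuous fun x : ℝ => (lp.single (E := fun _ : ℕ => ℝ) 1 k x) :=
    (lp.isometry_single (E := fun _ : ℕ => ℝ) (p := 1) k).continuous
  have := continuous_cutoff k
  fun_prop

theorem finSeq_combo (N a b : ℝ) (z z' : ℕ → ℝ) :
    finSeq (N, a • z + b • z') = a • finSeq (N, z) + b • finSeq (N, z') := by
  obtain ⟨M, hM⟩ := exists_nat_gt (N + 1)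
  rw [finSeq_eq_sum (M := M) hM.le, finSeq_eq_sum (M := M) hM.le, finSeq_eq_sum (M := M) hM.le,
    Finset.smul_sum, Finset.smul_sum, ← Finset.sum_add_distrib]
  refine Finset.sum_congr rfl fun k _ => ?_
  rw [← lp.single_smul, ← lp.single_smul, ← lp.single_add]
  congr 1
  simp
  ring

theorem exists_finSeq_eq {N N' : ℝ} (h : N ≤ N') (z : ℕ → ℝ) :
    ∃ z', finSeq (N', z') = finSeq (N, z) := by
  refine ⟨fun k => cutoff k N / cutoff k N' * z k, ?_⟩
  obtain ⟨M, hM⟩ := exists_nat_gt (N' + 1)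
  rw [finSeq_eq_sum (M := M) hM.le, finSeq_eq_sum (M := M) (by simp only; linarith)]
  refine Finset.sum_congr rfl fun k _ => ?_
  congr 1
  simp only
  by_cases h0 : cutoff k N' = 0
  · have : cutoff k N = 0 := le_antisymm (h0 ▸ cutoff_mono k h) (cutoff_nonneg _ _)
    simp [h0, this]
  · field_simp

theorem exists_finSeq_dist_lt (x : ellOne) {ε : ℝ} (hε : 0 < ε) :
    ∃ q, dist (finSeq q) x < ε := by
  have h1 := (lp.hasSum_single ENNReal.one_ne_top x).tendsto_sum_nat
  obtain ⟨n, hn⟩ := ((Metric.tendsto_nhds.1 h1) ε hε).exists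
  refine ⟨((n : ℝ), fun k => if k < n then x k else 0), ?_⟩
  convert hn using 2
  rw [finSeq_eq_sum (M := n + 1) (by simp), Finset.sum_range_succ]
  simp only [lt_irrefl, if_false, mul_zero, lp.single_zero, add_zero]
  refine Finset.sum_congr rfl fun k hk => ?_
  rw [Finset.mem_range] at hk
  simp [hk, cutoff_eq_one (Nat.cast_le.2 hk.le)]

/-- Absorption data for the space of summable sequences over a point. -/
noncomputable def ellOneData : AbsorptionData ellOne Unit (ℝ × (ℕ → ℝ)) where
  p _ := ()
  continuous_p := continuous_const
  D := univ
  isOpen_D := isOpen_univ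
  r q := finSeq q.2
  continuousOn_r := (continuous_finSeq.comp continuous_snd).continuousOn
  p_r _ _ := rfl
  exists_mem_D _ := ⟨0, mem_univ _⟩
  dense_r x ε hε := by simpa using exists_finSeq_dist_lt x hε
  Adm _ f := ∀ a, Convex ℝ {x | f x < a}
  adm_const _ a a' := by
    by_cases h : a < a' <;> simp [h, convex_univ, convex_empty]
  adm_dist y a := convex_ball y a
  adm_max _ f g hf hg a := by
    simpa only [max_lt_iff, ofPred_and] using (hf a).inter (hg a)
  adm_add _ f a hf a' := by
    simpa only [lt_sub_iff_add_lt] using hf (a' - a)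
  trivial_sublevel := by
    intro S _ _ β hβ f hf ha hne
    have hfc : Continuous fun q : S × (ℝ × (ℕ → ℝ)) => f q.1 (finSeq q.2) :=
      hf.comp (continuous_fst.prodMk (continuous_finSeq.comp continuous_snd))
    let O₁ : Set (S × ℝ) := {q | ∃ z, f q.1 (finSeq (q.2, z)) < 0}
    have hO₁ : IsOpen O₁ := by
      have h1 : IsOpen {q : (S × ℝ) × (ℕ → ℝ) | f q.1.1 (finSeq (q.1.2, q.2)) < 0} :=
        isOpen_lt (hfc.comp (by fun_prop : Continuous fun q : (S × ℝ) × (ℕ → ℝ) =>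
          (q.1.1, (q.1.2, q.2)))) continuous_const
      convert isOpenMap_fst _ h1 using 1
      ext q
      constructor
      · rintro ⟨z, hz⟩
        exact ⟨(q, z), hz, rfl⟩
      · rintro ⟨⟨q, z⟩, hz, rfl⟩
        exact ⟨z, hz⟩
    have ht₁ : TrivialOver ℝ O₁ := by
      refine trivialOver_of_convex hO₁ (fun s => ?_) fun s => OrdConnected.convex ⟨?_⟩
      · obtain ⟨⟨N, z⟩, -, h⟩ := hne s
        exact ⟨N, z, h⟩
      · rintro N ⟨z, hz⟩ N' - M hM
        obtain ⟨z', hz'⟩ := exists_finSeq_eq hM.1 z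
        refine ⟨z', ?_⟩
        simp only
        rwa [hz']
    have := metrizableSpace_nat_pi ℝ
    let O₂ : Set (O₁ × (ℕ → ℝ)) := {q | f q.1.1.1 (finSeq (q.1.1.2, q.2)) < 0}
    have ht₂ : TrivialOver (ℕ → ℝ) O₂ := by
      refine trivialOver_of_convex ?_ (fun o => o.2) fun o => ?_
      · exact isOpen_lt (hfc.comp (by fun_prop : Continuous fun q : O₁ × (ℕ → ℝ) =>
          (q.1.1.1, (q.1.1.2, q.2)))) continuous_const
      · intro z hz z' hz' a b h0 h1 hab
        have := ha o.1.1 0 hz hz' h0 h1 hab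
        rw [← finSeq_combo] at this
        exact this
    refine ht₁.comp ht₂ fun s N z => ?_
    constructor
    · rintro ⟨-, h⟩
      exact ⟨⟨z, h⟩, h⟩
    · rintro ⟨_, h⟩
      exact ⟨mem_univ _, h⟩

/-- Sequences of sequences are sequences. -/
noncomputable def seqSeqHomeomorph : (ℕ → ℕ → ℝ) ≃ₜ (ℕ → ℝ) where
  toFun u n := u n.unpair.1 n.unpair.2
  invFun v i j := v (Nat.pair i j)
  left_inv u := by simp
  right_inv v := by simp
  continuous_toFun := by fun_prop
  continuous_invFun := by fun_prop

/-- A pair of sequences is a sequence of pairs. -/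
def seqProdHomeomorph (A B : Type*) [TopologicalSpace A] [TopologicalSpace B] :
    (ℕ → A) × (ℕ → B) ≃ₜ (ℕ → A × B) where
  toFun u n := (u.1 n, u.2 n)
  invFun v := (fun n => (v n).1, fun n => (v n).2)
  left_inv u := rfl
  right_inv v := rfl
  continuous_toFun := by fun_prop
  continuous_invFun := by fun_prop

/-- A pair of real sequences is a real sequence. -/
noncomputable def seqPairHomeomorph : (ℕ → ℝ) × (ℕ → ℝ) ≃ₜ (ℕ → ℝ) :=
  Homeomorph.sumArrowHomeomorphProdArrow.symm.trans
    (Homeomorph.piCongrLeft (Y := fun _ => ℝ) Equiv.natSumNatEquivNat)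

/-- A real number and a real sequence form a real sequence. -/
noncomputable def seqConsHomeomorph : ℝ × (ℕ → ℝ) ≃ₜ (ℕ → ℝ) :=
  (((Homeomorph.prodComm _ _).trans ((Homeomorph.refl _).prodCongr
    (Homeomorph.funUnique Unit ℝ).symm)).trans
    Homeomorph.sumArrowHomeomorphProdArrow.symm).trans
    (Homeomorph.piCongrLeft (Y := fun _ => ℝ) Equiv.natSumPUnitEquivNat)

theorem nonempty_homeomorph_ellOne_prod :
    Nonempty (ellOne × (ℕ → ℝ) ≃ₜ (ℕ → ℝ)) := by
  have := metrizableSpace_nat_pi ℝ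
  obtain ⟨h, -⟩ := ellOneData.exists_homeomorph
  let e : (ℕ → ℝ × (ℝ × (ℕ → ℝ))) ≃ₜ (ℕ → ℝ) :=
    (Homeomorph.piCongrRight fun _ =>
      ((Homeomorph.refl ℝ).prodCongr seqConsHomeomorph).trans seqConsHomeomorph).trans
    seqSeqHomeomorph
  exact ⟨((((Homeomorph.refl _).prodCongr e.symm).trans h).trans (Homeomorph.uniqueProd _ _)).trans
    e⟩

theorem nonempty_homeomorph_seq_ellOne_prod :
    Nonempty ((ℕ → ℝ × ellOne) × (ℕ → ℝ) ≃ₜ (ℕ → ℝ)) := by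
  obtain ⟨h⟩ := nonempty_homeomorph_ellOne_prod
  exact ⟨((((Homeomorph.refl _).prodCongr seqSeqHomeomorph.symm).trans
    (seqProdHomeomorph _ _)).trans (Homeomorph.piCongrRight fun _ =>
      ((Homeomorph.prodAssoc _ _ _).trans ((Homeomorph.refl ℝ).prodCongr h)).trans
        seqConsHomeomorph)).trans seqSeqHomeomorph⟩

end TrivialFamilies

section WeightedMetric

open Set Filter Topology Uniformity

/-- Positive weights on a set of coordinates, tending to zero. -/
class CoordWeight (ι : Type*) where
  /-- the weight of a coordinate -/
  weight : ι → ℝ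
  weight_pos : ∀ i, 0 < weight i
  weight_le_one : ∀ i, weight i ≤ 1
  finite_le_weight : ∀ ε, 0 < ε → {i | ε ≤ weight i}.Finite

open CoordWeight

noncomputable instance : CoordWeight ℕ where
  weight n := (1 / 2) ^ n
  weight_pos n := by positivity
  weight_le_one n := pow_le_one₀ (by norm_num) (by norm_num)
  finite_le_weight ε hε := by
    have h := (tendsto_pow_atTop_nhds_zero_of_lt_one (r := (1 / 2 : ℝ)) (by norm_num)
      (by norm_num)).eventually_lt_const hε
    rw [← Nat.cofinite_eq_atTop, eventually_cofinite] at h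
    simpa using h

noncomputable instance {ι κ : Type*} [CoordWeight ι] [CoordWeight κ] : CoordWeight (ι ⊕ κ) where
  weight := Sum.elim weight weight
  weight_pos i := by rcases i with i | i <;> simp [weight_pos]
  weight_le_one i := by rcases i with i | i <;> simp [weight_le_one]
  finite_le_weight ε hε := by
    refine (((finite_le_weight (ι := ι) ε hε).image Sum.inl).union
      ((finite_le_weight (ι := κ) ε hε).image Sum.inr)).subset ?_
    rintro (i | i) hi
    · exact Or.inl ⟨i, hi, rfl⟩
    · exact Or.inr ⟨i, hi, rfl⟩

/-- A closed max-plus convex set contains the suprema of its infinite max-plus combinations. -/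
theorem MaxPlusConvex.mem_of_isLUB {ι : Type*} {A : Set (ι → ℝ)} (hA : MaxPlusConvex A) (hc : IsClosed A)
    {T : Set (ℝ × (ι → ℝ))} (hT : ∀ q ∈ T, q.1 ≤ 0 ∧ q.2 ∈ A) (h0 : ∃ a, ((0 : ℝ), a) ∈ T)
    {x : ι → ℝ} (hx : ∀ j, IsLUB ((fun q : ℝ × (ι → ℝ) => q.1 + q.2 j) '' T) (x j)) : x ∈ A := by
  obtain ⟨a₀, ha₀⟩ := h0
  have hfin : ∀ s : Finset T, ∃ y ∈ A, a₀ ≤ y ∧ y ≤ x ∧ ∀ q ∈ s, ∀ j, q.1.1 + q.1.2 j ≤ y j := by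
    intro s
    classical
    induction s using Finset.induction_on with
    | empty =>
      refine ⟨a₀, (hT _ ha₀).2, le_rfl, fun j => (hx j).1 ⟨_, ha₀, by simp⟩, by simp⟩
    | insert q s hq ih =>
      obtain ⟨y, hyA, hay, hyx, hy⟩ := ih
      refine ⟨_, hA y hyA _ (hT _ q.2).2 _ (hT _ q.2).1, fun j => le_max_of_le_left (hay j),
        fun j => max_le (hyx j) ((hx j).1 ⟨_, q.2, rfl⟩), ?_⟩
      intro q' hq' j
      rcases Finset.mem_insert.1 hq' with rfl | h
      · exact le_max_right _ _
      · exact le_max_of_le_left (hy q' h j)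
  have hcomp : IsCompact (A ∩ Icc a₀ x) := (isCompact_Icc (a := a₀) (b := x)).inter_left hc
  obtain ⟨y, hy⟩ := hcomp.inter_iInter_nonempty (fun q : T => {y | ∀ j, q.1.1 + q.1.2 j ≤ y j})
    (fun q => by
      rw [ofPred_forall]
      exact isClosed_iInter fun j => isClosed_le continuous_const (continuous_apply j))
    (fun s => by
      obtain ⟨y, hyA, hay, hyx, hy⟩ := hfin s
      exact ⟨y, ⟨hyA, hay, hyx⟩, mem_iInter₂.2 fun q hq => hy q hq⟩)
  have : y = x := by
    refine le_antisymm hy.1.2.2 fun j => (hx j).2 ?_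
    rintro _ ⟨q, hq, rfl⟩
    exact mem_iInter.1 hy.2 ⟨q, hq⟩ j
  exact this ▸ hy.1.1

section Metric

variable {ι : Type*} [CoordWeight ι]

/-- The supremum of the coordinate distances, truncated by the weights. -/
noncomputable def supDist (x y : ι → ℝ) : ℝ := ⨆ i, min |x i - y i| (weight i)

theorem min_le_supDist (x y : ι → ℝ) (i : ι) : min |x i - y i| (weight i) ≤ supDist x y :=
  le_ciSup (f := fun i => min |x i - y i| (weight i))
    ⟨1, by rintro _ ⟨i, rfl⟩; exact (min_le_right _ _).trans (weight_le_one i)⟩ i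

theorem supDist_nonneg (x y : ι → ℝ) : 0 ≤ supDist x y :=
  Real.iSup_nonneg fun i => le_min (abs_nonneg _) (weight_pos i).le

theorem supDist_le_iff {x y : ι → ℝ} {r : ℝ} (hr : 0 ≤ r) :
    supDist x y ≤ r ↔ ∀ i, r < weight i → |x i - y i| ≤ r := by
  constructor
  · intro h i hi
    have := (min_le_supDist x y i).trans h
    rcases min_le_iff.1 this with h | h
    · exact h
    · linarith
  · intro h
    refine Real.iSup_le (fun i => ?_) hr
    rcases lt_or_ge r (weight i) with hi | hi
    · exact (min_le_left _ _).trans (h i hi)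
    · exact (min_le_right _ _).trans hi

theorem supDist_triangle (x y z : ι → ℝ) : supDist x z ≤ supDist x y + supDist y z := by
  rw [supDist_le_iff (add_nonneg (supDist_nonneg _ _) (supDist_nonneg _ _))]
  intro i hi
  have h1 := (supDist_le_iff (supDist_nonneg x y)).1 le_rfl i
    (by linarith [supDist_nonneg y z])
  have h2 := (supDist_le_iff (supDist_nonneg y z)).1 le_rfl i
    (by linarith [supDist_nonneg x y])
  exact (abs_sub_le _ (y i) _).trans (add_le_add h1 h2)

theorem eq_of_supDist_eq_zero {x y : ι → ℝ} (h : supDist x y = 0) : x = y := by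
  funext i
  have := (supDist_le_iff le_rfl).1 h.le i (weight_pos i)
  exact sub_eq_zero.1 (abs_nonpos_iff.1 this)

theorem uniformity_eq_supDist :
    𝓤 (ι → ℝ) = ⨅ ε > 0, 𝓟 {p : (ι → ℝ) × (ι → ℝ) | supDist p.1 p.2 < ε} := by
  refine le_antisymm (le_iInf₂ fun ε hε => le_principal_iff.2 ?_) ?_
  · rw [Pi.uniformity]
    have hfin := finite_le_weight (ι := ι) (ε / 2) (half_pos hε)
    have h1 : (⋂ i ∈ {i : ι | ε / 2 ≤ weight i}, {p : (ι → ℝ) × (ι → ℝ) |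
        |p.1 i - p.2 i| < ε / 2}) ∈ ⨅ i, comap (fun a : (ι → ℝ) × (ι → ℝ) => (a.1 i, a.2 i)) (𝓤 ℝ) := by
      refine (biInter_mem hfin).2 fun i _ => mem_iInf_of_mem i ?_
      exact preimage_mem_comap (Metric.dist_mem_uniformity (half_pos hε))
    refine mem_of_superset h1 fun p hp => ?_
    simp only [mem_iInter, mem_ofPred_eq] at hp
    have : supDist p.1 p.2 ≤ ε / 2 := by
      rw [supDist_le_iff (half_pos hε).le]
      exact fun i hi => (hp i hi.le).le
    simp only [mem_ofPred_eq]
    linarith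
  · rw [Pi.uniformity]
    refine le_iInf fun i => ?_
    rw [← tendsto_iff_comap]
    rw [(Metric.uniformity_basis_dist (α := ℝ)).tendsto_right_iff]
    intro ε hε
    refine mem_iInf_of_mem (min ε (weight i)) (mem_iInf_of_mem (lt_min hε (weight_pos i)) ?_)
    refine mem_principal.2 fun p hp => ?_
    have hp' : supDist p.1 p.2 < min ε (weight i) := hp
    have h1 := (supDist_le_iff (supDist_nonneg p.1 p.2)).1 le_rfl i
      (hp'.trans_le (min_le_right _ _))
    exact (h1.trans_lt hp').trans_le (min_le_left _ _)

noncomputable instance supMetricSpace : MetricSpace (ι → ℝ) where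
  dist := supDist
  dist_self x := le_antisymm ((supDist_le_iff le_rfl).2 fun i _ => by simp) (supDist_nonneg _ _)
  dist_comm x y := by
    show supDist x y = supDist y x
    simp only [supDist, abs_sub_comm]
  dist_triangle := supDist_triangle
  eq_of_dist_eq_zero := eq_of_supDist_eq_zero
  toUniformSpace := Pi.uniformSpace _
  uniformity_dist := uniformity_eq_supDist

theorem supDist_le {x y : ι → ℝ} {r : ℝ} (hr : 0 ≤ r) :
    dist x y ≤ r ↔ ∀ i, r < weight i → |x i - y i| ≤ r := supDist_le_iff hr

/-- The points at distance at most `r` from a set. -/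
def nearSet (A : Set (ι → ℝ)) (r : ℝ) : Set (ι → ℝ) := {x | ∃ a ∈ A, dist x a ≤ r}

theorem dist_max_le {x x' y y' : ι → ℝ} {r t : ℝ} (h : dist x y ≤ r) (h' : dist x' y' ≤ r) :
    dist (fun i => max (x i) (t + x' i)) (fun i => max (y i) (t + y' i)) ≤ r := by
  have hr : 0 ≤ r := dist_nonneg.trans h
  rw [supDist_le hr] at *
  intro i hi
  refine (abs_max_sub_max_le_max _ _ _ _).trans (max_le (h i hi) ?_)
  simpa using h' i hi

theorem maxPlusConvex_nearSet {A : Set (ι → ℝ)} (hA : MaxPlusConvex A) (r : ℝ) :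
    MaxPlusConvex (nearSet A r) := by
  rintro a ⟨a', ha', h⟩ b ⟨b', hb', h'⟩ t ht
  exact ⟨_, hA a' ha' b' hb' t ht, dist_max_le h h'⟩

theorem isClosed_nearSet {A : Set (ι → ℝ)} (hA : IsCompact A) (r : ℝ) :
    IsClosed (nearSet A r) := by
  rcases A.eq_empty_or_nonempty with rfl | hne
  · convert isClosed_empty using 1
    simp [nearSet]
  have h : nearSet A r = {x | Metric.infDist x A ≤ r} := by
    ext x
    constructor
    · rintro ⟨a, ha, h⟩
      exact (Metric.infDist_le_dist_of_mem ha).trans h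
    · intro h
      obtain ⟨a, ha, h'⟩ := hA.exists_infDist_eq_dist hne x
      exact ⟨a, ha, h' ▸ h⟩
  rw [h]
  exact isClosed_le (Metric.continuous_infDist_pt A) continuous_const

end Metric

theorem maxPlusConvex_singleton {ι : Type*} (a : ι → ℝ) : MaxPlusConvex {a} := by
  rintro _ rfl _ rfl t ht
  ext i
  simp [ht]

end WeightedMetric

section Hyperspaces

open Set Filter Topology Uniformity TopologicalSpace
open CoordWeight

section Hausdorff

variable {Z : Type*} [MetricSpace Z]

theorem NonemptyCompacts.dist_le_iff {A B : NonemptyCompacts Z} {r : ℝ} (hr : 0 ≤ r) :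
    dist A B ≤ r ↔ (∀ a ∈ A, ∃ b ∈ B, dist a b ≤ r) ∧ ∀ b ∈ B, ∃ a ∈ A, dist b a ≤ r := by
  rw [Metric.NonemptyCompacts.dist_eq]
  constructor
  · intro h
    have hfin : Metric.hausdorffEDist (A : Set Z) B ≠ ⊤ :=
      Metric.hausdorffEDist_ne_top_of_nonempty_of_bounded A.nonempty B.nonempty
        A.isCompact.isBounded B.isCompact.isBounded
    constructor
    · intro a ha
      obtain ⟨b, hb, h'⟩ := B.isCompact.exists_infDist_eq_dist B.nonempty a
      exact ⟨b, hb, h' ▸ (Metric.infDist_le_hausdorffDist_of_mem ha hfin).trans h⟩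
    · intro b hb
      obtain ⟨a, ha, h'⟩ := A.isCompact.exists_infDist_eq_dist A.nonempty b
      refine ⟨a, ha, h' ▸ (Metric.infDist_le_hausdorffDist_of_mem hb ?_).trans ?_⟩
      · rwa [Metric.hausdorffEDist_comm]
      · rwa [Metric.hausdorffDist_comm]
  · rintro ⟨h1, h2⟩
    exact Metric.hausdorffDist_le_of_mem_dist hr h1 h2

end Hausdorff

section SupOn

variable {Z : Type*} [TopologicalSpace Z]

/-- The supremum of a function over a nonempty compact set. -/
noncomputable def supOn (h : Z → ℝ) (K : NonemptyCompacts Z) : ℝ := sSup (h '' K)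

theorem isGreatest_supOn {h : Z → ℝ} (hh : Continuous h) (K : NonemptyCompacts Z) :
    IsGreatest (h '' K) (supOn h K) :=
  (K.isCompact.image hh).isGreatest_sSup (K.nonempty.image h)

theorem le_supOn {h : Z → ℝ} (hh : Continuous h) {K : NonemptyCompacts Z} {x : Z} (hx : x ∈ K) :
    h x ≤ supOn h K := (isGreatest_supOn hh K).2 ⟨x, hx, rfl⟩

theorem exists_eq_supOn {h : Z → ℝ} (hh : Continuous h) (K : NonemptyCompacts Z) :
    ∃ x ∈ K, h x = supOn h K := (isGreatest_supOn hh K).1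

theorem supOn_le_iff {h : Z → ℝ} (hh : Continuous h) {K : NonemptyCompacts Z} {c : ℝ} :
    supOn h K ≤ c ↔ ∀ x ∈ K, h x ≤ c := by
  rw [isLUB_le_iff (isGreatest_supOn hh K).isLUB]
  exact ⟨fun H x hx => H ⟨x, hx, rfl⟩, by rintro H _ ⟨x, hx, rfl⟩; exact H x hx⟩

theorem continuous_supOn_id : Continuous (supOn (id : ℝ → ℝ)) := by
  refine continuous_iff_lower_upperSemicontinuous.2 ⟨?_, ?_⟩
  · intro K c hc
    obtain ⟨x, hx, h⟩ := exists_eq_supOn continuous_id K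
    filter_upwards [(NonemptyCompacts.isOpen_inter_nonempty_of_isOpen (isOpen_Ioi (a := c))).mem_nhds
      (show ((K : Set ℝ) ∩ Ioi c).Nonempty from ⟨x, hx, by rw [← h] at hc; exact hc⟩)] with L hL
    obtain ⟨y, hy, hyc⟩ := hL
    exact lt_of_lt_of_le hyc (le_supOn continuous_id hy)
  · intro K c hc
    filter_upwards [(NonemptyCompacts.isOpen_subsets_of_isOpen (isOpen_Iio (a := c))).mem_nhds
      (show (K : Set ℝ) ⊆ Iio c from fun x hx => lt_of_le_of_lt (le_supOn continuous_id hx) hc)]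
      with L hL
    obtain ⟨x, hx, h⟩ := exists_eq_supOn continuous_id L
    rw [← h]
    exact hL hx

theorem Continuous.supOn {P : Type*} [TopologicalSpace P] {h : P → Z → ℝ} {K : P → NonemptyCompacts Z}
    (hh : Continuous fun q : P × Z => h q.1 q.2) (hK : Continuous K) :
    Continuous fun p => supOn (h p) (K p) := by
  have h1 := continuous_supOn_id.comp (Continuous.nonemptyCompacts_map' (g := h) hK hh)
  refine h1.congr fun p => ?_
  simp [_root_.supOn]

end SupOn

/-- The hyperspace of nonempty compact max-plus convex sets. -/
abbrev MaxPlusCompacts (ι : Type*) : Type _ :=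
  {A : NonemptyCompacts (ι → ℝ) // MaxPlusConvex (A : Set (ι → ℝ))}

section MaxPlusCompacts

variable {ι : Type*}

theorem isClosed_setOf_maxPlusConvex [CoordWeight ι] :
    IsClosed {A : NonemptyCompacts (ι → ℝ) | MaxPlusConvex (A : Set (ι → ℝ))} := by
  refine isClosed_of_closure_subset fun A hA => ?_
  intro a ha b hb t ht
  have key : ∀ ε > 0, Metric.infDist (fun i => max (a i) (t + b i)) (A : Set (ι → ℝ)) ≤ ε + ε := by
    intro ε hε
    obtain ⟨B, hB, hAB⟩ := Metric.mem_closure_iff.1 hA ε hε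
    obtain ⟨h1, h2⟩ := (NonemptyCompacts.dist_le_iff hε.le).1 hAB.le
    obtain ⟨a', ha', h⟩ := h1 a ha
    obtain ⟨b', hb', h'⟩ := h1 b hb
    obtain ⟨c, hc, h''⟩ := h2 _ (hB a' ha' b' hb' t ht)
    exact (Metric.infDist_le_dist_of_mem hc).trans
      ((dist_triangle _ _ _).trans (add_le_add (dist_max_le h h') h''))
  refine (A.isCompact.isClosed.mem_iff_infDist_zero A.nonempty).2
    (le_antisymm (le_of_forall_pos_le_add fun ε hε => ?_) Metric.infDist_nonneg)
  simpa using key (ε / 2) (half_pos hε)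

instance [CoordWeight ι] : CompleteSpace (MaxPlusCompacts ι) :=
  (isClosed_setOf_maxPlusConvex (ι := ι)).completeSpace_coe

/-- The closed max-plus convex hull. -/
def maxPlusHull (G : Set (ι → ℝ)) : Set (ι → ℝ) :=
  ⋂₀ {N | IsClosed N ∧ MaxPlusConvex N ∧ G ⊆ N}

theorem subset_maxPlusHull (G : Set (ι → ℝ)) : G ⊆ maxPlusHull G :=
  subset_sInter fun _ hN => hN.2.2

theorem maxPlusHull_subset {G N : Set (ι → ℝ)} (hc : IsClosed N) (hN : MaxPlusConvex N)
    (h : G ⊆ N) : maxPlusHull G ⊆ N := sInter_subset_of_mem ⟨hc, hN, h⟩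

theorem isClosed_maxPlusHull (G : Set (ι → ℝ)) : IsClosed (maxPlusHull G) :=
  isClosed_sInter fun _ hN => hN.1

theorem maxPlusConvex_maxPlusHull (G : Set (ι → ℝ)) : MaxPlusConvex (maxPlusHull G) :=
  fun a ha b hb t ht N hN => hN.2.1 a (ha N hN) b (hb N hN) t ht

theorem maxPlusConvex_Icc (x y : ι → ℝ) : MaxPlusConvex (Icc x y) := by
  intro a ha b hb t ht
  refine ⟨fun i => le_max_of_le_left (ha.1 i), fun i => max_le (ha.2 i) ?_⟩
  linarith [hb.2 i]

theorem isCompact_maxPlusHull {G : Set (ι → ℝ)} (hG : IsCompact G) : IsCompact (maxPlusHull G) := by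
  have hb : BddBelow G ∧ BddAbove G := by
    rw [bddBelow_pi, bddAbove_pi]
    exact ⟨fun i => (hG.image (continuous_apply i)).bddBelow,
      fun i => (hG.image (continuous_apply i)).bddAbove⟩
  obtain ⟨⟨x, hx⟩, ⟨y, hy⟩⟩ := hb
  exact (isCompact_Icc (a := x) (b := y)).of_isClosed_subset (isClosed_maxPlusHull G)
    (maxPlusHull_subset isClosed_Icc (maxPlusConvex_Icc x y) fun g hg => ⟨hx hg, hy hg⟩)

/-- The closed max-plus convex hull of a nonempty compact set. -/
def MaxPlusCompacts.hull (G : NonemptyCompacts (ι → ℝ)) : MaxPlusCompacts ι :=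
  ⟨⟨⟨maxPlusHull G, isCompact_maxPlusHull G.isCompact⟩, G.nonempty.mono (subset_maxPlusHull _)⟩,
    maxPlusConvex_maxPlusHull _⟩

theorem MaxPlusCompacts.continuous_hull [CoordWeight ι] : Continuous (hull (ι := ι)) := by
  refine LipschitzWith.continuous (K := 1) (LipschitzWith.of_dist_le_mul fun G G' => ?_)
  have key : ∀ G G' : NonemptyCompacts (ι → ℝ), ∀ a ∈ maxPlusHull (G : Set (ι → ℝ)),
      ∃ b ∈ maxPlusHull (G' : Set (ι → ℝ)), dist a b ≤ dist G G' := by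
    intro G G' a ha
    refine maxPlusHull_subset (isClosed_nearSet (isCompact_maxPlusHull G'.isCompact) _)
      (maxPlusConvex_nearSet (maxPlusConvex_maxPlusHull _) _) (fun g hg => ?_) ha
    obtain ⟨b, hb, h⟩ := ((NonemptyCompacts.dist_le_iff dist_nonneg).1 le_rfl).1 g hg
    exact ⟨b, subset_maxPlusHull _ hb, h⟩
  rw [NNReal.coe_one, one_mul]
  refine (NonemptyCompacts.dist_le_iff dist_nonneg).2 ⟨key G G', ?_⟩
  rw [dist_comm]
  exact key G' G

end MaxPlusCompacts

section Sections

variable {ι κ η : Type*}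

/-- The restriction of a point to the first block of coordinates. -/
def firstBlock (x : ι ⊕ κ → ℝ) : ι → ℝ := fun i => x (Sum.inl i)

theorem continuous_firstBlock : Continuous (firstBlock (ι := ι) (κ := κ)) :=
  continuous_pi fun i => continuous_apply (Sum.inl i)

/-- The map induced by `firstBlock` on nonempty compact max-plus convex sets. -/
def MaxPlusCompacts.proj (A : MaxPlusCompacts (ι ⊕ κ)) : MaxPlusCompacts ι :=
  ⟨A.1.map firstBlock continuous_firstBlock, by
    rintro _ ⟨a, ha, rfl⟩ _ ⟨b, hb, rfl⟩ t ht
    exact ⟨_, A.2 a ha b hb t ht, rfl⟩⟩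

theorem MaxPlusCompacts.mem_proj {A : MaxPlusCompacts (ι ⊕ κ)} {u : ι → ℝ} :
    u ∈ A.proj.1 ↔ ∃ x ∈ A.1, firstBlock x = u := Iff.rfl

theorem MaxPlusCompacts.continuous_proj : Continuous (proj (ι := ι) (κ := κ)) :=
  Continuous.subtype_mk (continuous_firstBlock.nonemptyCompacts_map.comp continuous_subtype_val) _

variable [CoordWeight ι]

/-- The max-plus combination of the points `x` of `A` with coefficients
`-K * dist u (π x)`, normalized so that the largest coefficient vanishes. -/
noncomputable def penalized (π : (η → ℝ) → ι → ℝ) (K : ℝ) (A : NonemptyCompacts (η → ℝ))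
    (u : ι → ℝ) : η → ℝ := fun j =>
  supOn (fun x => x j - K * dist u (π x)) A - K * supOn (fun x => -dist u (π x)) A

theorem continuous_penalized {π : (η → ℝ) → ι → ℝ} (hπ : Continuous π) (K : ℝ) :
    Continuous fun q : NonemptyCompacts (η → ℝ) × (ι → ℝ) => penalized π K q.1 q.2 := by
  refine continuous_pi fun j => ?_
  have hd : Continuous fun q : (NonemptyCompacts (η → ℝ) × (ι → ℝ)) × (η → ℝ) =>
      dist q.1.2 (π q.2) := continuous_fst.snd.dist (hπ.comp continuous_snd)
  refine Continuous.sub (Continuous.supOn ?_ continuous_fst)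
    (continuous_const.mul (Continuous.supOn ?_ continuous_fst))
  · exact ((continuous_apply j).comp continuous_snd).sub (continuous_const.mul hd)
  · exact hd.neg

theorem penalized_mem {π : (η → ℝ) → ι → ℝ} (hπ : Continuous π) {K : ℝ} (hK : 0 ≤ K)
    {A : NonemptyCompacts (η → ℝ)} (hA : MaxPlusConvex (A : Set (η → ℝ))) (u : ι → ℝ) :
    penalized π K A u ∈ A := by
  have hd : Continuous fun x => dist u (π x) := continuous_const.dist hπ
  have hn : Continuous fun x => -dist u (π x) := hd.neg
  have hT : ∀ x ∈ A, -(K * dist u (π x)) - K * supOn (fun x => -dist u (π x)) A ≤ 0 := by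
    intro x hx
    nlinarith [le_supOn hn hx]
  refine hA.mem_of_isLUB A.isCompact.isClosed
    (T := (fun x => (-(K * dist u (π x)) - K * supOn (fun x => -dist u (π x)) A, x)) '' A)
    ?_ ?_ fun j => ?_
  · rintro _ ⟨x, hx, rfl⟩
    exact ⟨hT x hx, hx⟩
  · obtain ⟨x, hx, h⟩ := exists_eq_supOn hn A
    refine ⟨x, x, hx, ?_⟩
    simp only [← h, mul_neg, sub_neg_eq_add, neg_add_cancel]
  · have hc : Continuous fun x : η → ℝ => x j - K * dist u (π x) :=
      (continuous_apply j).sub (continuous_const.mul hd)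
    rw [image_image]
    constructor
    · rintro _ ⟨x, hx, rfl⟩
      have := le_supOn hc hx
      simp only [penalized]
      linarith
    · intro c hc'
      obtain ⟨x, hx, h⟩ := exists_eq_supOn hc A
      have := hc' ⟨x, hx, rfl⟩
      simp only [penalized]
      rw [← h]
      simp only at this
      linarith

theorem supOn_map {Z Z' : Type*} [TopologicalSpace Z] [TopologicalSpace Z'] {g : Z → Z'}
    (hg : Continuous g) (h : Z' → ℝ) (A : NonemptyCompacts Z) :
    supOn h (A.map g hg) = supOn (fun x => h (g x)) A := by
  simp [supOn, image_image]

theorem firstBlock_penalized (K : ℝ) (A : MaxPlusCompacts (ι ⊕ κ)) (u : ι → ℝ) :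
    firstBlock (penalized firstBlock K A.1 u) = penalized id K A.proj.1 u := by
  funext i
  simp only [firstBlock, penalized, MaxPlusCompacts.proj, supOn_map, id]

theorem exists_dist_penalized_le (b : NonemptyCompacts (ι → ℝ)) {ε : ℝ} (hε : 0 < ε) :
    ∃ K : ℕ, ∀ u ∈ b, dist (penalized id K b u) u ≤ ε := by
  have hfin := finite_le_weight (ι := ι) ε hε
  have hbd : ∀ i : ι, ∃ M : ℝ, ∀ u ∈ b, ∀ v ∈ b, v i - u i ≤ M := by
    intro i
    obtain ⟨M, hM⟩ := (b.isCompact.image (continuous_apply i)).bddAbove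
    obtain ⟨M', hM'⟩ := (b.isCompact.image (continuous_apply i)).bddBelow
    refine ⟨M - M', fun u hu v hv => ?_⟩
    have h1 := hM ⟨v, hv, rfl⟩
    have h2 := hM' ⟨u, hu, rfl⟩
    simp only at h1 h2
    linarith
  choose M hM using hbd
  obtain ⟨C, hC⟩ := (hfin.image fun i => M i / weight i).bddAbove
  obtain ⟨K, hK⟩ := exists_nat_ge (max C 1)
  refine ⟨K, fun u hu => ?_⟩
  have hK0 : (0 : ℝ) ≤ K := Nat.cast_nonneg K
  have hK1 : (1 : ℝ) ≤ K := (le_max_right _ _).trans hK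
  have hd : Continuous fun x : ι → ℝ => dist u (id x) := continuous_const.dist continuous_id
  have hn : Continuous fun x : ι → ℝ => -dist u (id x) := hd.neg
  have h0 : supOn (fun x => -dist u (id x)) b = 0 := by
    refine le_antisymm ((supOn_le_iff hn).2 fun x _ => by simp) ?_
    simpa using le_supOn hn hu
  rw [supDist_le hε.le]
  intro i hi
  have hc : Continuous fun x : ι → ℝ => x i - K * dist u (id x) :=
    (continuous_apply i).sub (continuous_const.mul hd)
  simp only [penalized, h0, mul_zero, sub_zero]
  have hge : u i ≤ supOn (fun x : ι → ℝ => x i - K * dist u (id x)) b := by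
    simpa using le_supOn hc hu
  have hle : supOn (fun x : ι → ℝ => x i - K * dist u (id x)) b ≤ u i := by
    refine (supOn_le_iff hc).2 fun v hv => ?_
    have hmin := min_le_supDist u v i
    have hdist : dist u (id v) = supDist u v := rfl
    rw [hdist]
    rcases min_le_iff.1 hmin with h | h
    · have := neg_abs_le (u i - v i)
      nlinarith [supDist_nonneg u v]
    · have h1 : M i / weight i ≤ K := ((hC ⟨i, hi.le, rfl⟩).trans (le_max_left _ _)).trans hK
      rw [div_le_iff₀ (weight_pos i)] at h1
      have := hM i u hu v hv
      nlinarith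
  rw [abs_of_nonneg (by linarith)]
  linarith

/-- The point `x` with its first block moved into `b`. -/
noncomputable def movePoint (K : ℕ) (b : NonemptyCompacts (ι → ℝ)) (x : ι ⊕ κ → ℝ) : ι ⊕ κ → ℝ :=
  Sum.elim (penalized id K b (firstBlock x)) fun j => x (Sum.inr j)

/-- A point with first block `u` and a second block determined by `A`. -/
noncomputable def liftPoint (K : ℕ) (A : NonemptyCompacts (ι ⊕ κ → ℝ)) (u : ι → ℝ) : ι ⊕ κ → ℝ :=
  Sum.elim u fun j => penalized firstBlock K A u (Sum.inr j)

theorem continuous_movePoint (K : ℕ) : Continuous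
    fun q : NonemptyCompacts (ι → ℝ) × (ι ⊕ κ → ℝ) => movePoint K q.1 q.2 := by
  refine continuous_pi ?_
  rintro (i | j)
  · have h : Continuous fun q : NonemptyCompacts (ι → ℝ) × (ι ⊕ κ → ℝ) => (q.1, firstBlock q.2) :=
      continuous_fst.prodMk (continuous_firstBlock.comp continuous_snd)
    exact (continuous_apply i).comp ((continuous_penalized continuous_id (K : ℝ)).comp h)
  · have h := (continuous_apply (A := fun _ : ι ⊕ κ => ℝ) (Sum.inr j)).comp
      (continuous_snd (X := NonemptyCompacts (ι → ℝ)))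
    exact h

theorem continuous_liftPoint (K : ℕ) : Continuous
    fun q : NonemptyCompacts (ι ⊕ κ → ℝ) × (ι → ℝ) => liftPoint K q.1 q.2 := by
  refine continuous_pi ?_
  rintro (i | j)
  · exact (continuous_apply i).comp continuous_snd
  · have h := (continuous_apply (A := fun _ : ι ⊕ κ => ℝ) (Sum.inr j)).comp
      (continuous_penalized continuous_firstBlock (K : ℝ))
    exact h

/-- A set over `b` obtained by deforming `A`. -/
noncomputable def MaxPlusCompacts.moveTo (K : ℕ) (A : MaxPlusCompacts (ι ⊕ κ))
    (b : MaxPlusCompacts ι) : MaxPlusCompacts (ι ⊕ κ) :=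
  hull (A.1.map (movePoint K b.1) (Continuous.uncurry_left b.1 (continuous_movePoint K)) ⊔
    b.1.map (liftPoint K A.1) (Continuous.uncurry_left A.1 (continuous_liftPoint K)))

theorem MaxPlusCompacts.proj_moveTo (K : ℕ) (A : MaxPlusCompacts (ι ⊕ κ))
    (b : MaxPlusCompacts ι) : (A.moveTo K b).proj = b := by
  refine Subtype.ext (SetLike.coe_injective (Subset.antisymm ?_ ?_))
  · rintro _ ⟨x, hx, rfl⟩
    refine maxPlusHull_subset (N := firstBlock ⁻¹' (b.1 : Set (ι → ℝ)))
      (b.1.isCompact.isClosed.preimage continuous_firstBlock)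
      (fun a ha a' ha' t ht => b.2 _ ha _ ha' t ht) ?_ hx
    rintro _ (⟨x, hx, rfl⟩ | ⟨u, hu, rfl⟩)
    · exact penalized_mem continuous_id (Nat.cast_nonneg K) b.2 _
    · exact hu
  · intro u hu
    exact ⟨_, subset_maxPlusHull _ (Or.inr ⟨u, hu, rfl⟩), rfl⟩

variable [CoordWeight κ]

/-- Two points with the same second block are as far apart as their first blocks. -/
theorem dist_sumElim_left (u v : ι → ℝ) (y : κ → ℝ) :
    dist (Sum.elim u y : ι ⊕ κ → ℝ) (Sum.elim v y) ≤ dist u v := by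
  rw [supDist_le dist_nonneg]
  rintro (i | i) hi
  · exact (supDist_le dist_nonneg).1 le_rfl i hi
  · simp [dist_nonneg]

theorem MaxPlusCompacts.continuous_moveTo (K : ℕ) :
    Continuous fun q : MaxPlusCompacts (ι ⊕ κ) × MaxPlusCompacts ι => q.1.moveTo K q.2 := by
  have h1 : Continuous fun q : (MaxPlusCompacts (ι ⊕ κ) × MaxPlusCompacts ι) × (ι ⊕ κ → ℝ) =>
      movePoint K q.1.2.1 q.2 := by
    have e : Continuous fun q : (MaxPlusCompacts (ι ⊕ κ) × MaxPlusCompacts ι) × (ι ⊕ κ → ℝ) =>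
        (q.1.2.1, q.2) := by fun_prop
    have h := (continuous_movePoint (ι := ι) (κ := κ) K).comp e
    exact h
  have h2 : Continuous fun q : (MaxPlusCompacts (ι ⊕ κ) × MaxPlusCompacts ι) × (ι → ℝ) =>
      liftPoint K q.1.1.1 q.2 := by
    have e : Continuous fun q : (MaxPlusCompacts (ι ⊕ κ) × MaxPlusCompacts ι) × (ι → ℝ) =>
        (q.1.1.1, q.2) := by fun_prop
    have h := (continuous_liftPoint (ι := ι) (κ := κ) K).comp e
    exact h
  have h3 := Continuous.nonemptyCompacts_map'
    (f := fun q : MaxPlusCompacts (ι ⊕ κ) × MaxPlusCompacts ι => q.1.1)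
    (g := fun q x => movePoint K q.2.1 x) (continuous_subtype_val.comp continuous_fst) h1
  have h4 := Continuous.nonemptyCompacts_map'
    (f := fun q : MaxPlusCompacts (ι ⊕ κ) × MaxPlusCompacts ι => q.2.1)
    (g := fun q u => liftPoint K q.1.1 u) (continuous_subtype_val.comp continuous_snd) h2
  exact continuous_hull.comp (h3.sup h4)

theorem MaxPlusCompacts.exists_dist_moveTo_le (A : MaxPlusCompacts (ι ⊕ κ)) {ε : ℝ} (hε : 0 < ε) :
    ∃ K : ℕ, dist (A.moveTo K A.proj) A ≤ ε := by
  obtain ⟨K, hK⟩ := exists_dist_penalized_le A.proj.1 hε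
  refine ⟨K, (NonemptyCompacts.dist_le_iff hε.le).2 ⟨fun a ha => ?_, fun x hx => ?_⟩⟩
  · refine maxPlusHull_subset (isClosed_nearSet A.1.isCompact ε)
      (maxPlusConvex_nearSet A.2 ε) ?_ ha
    rintro _ (⟨x, hx, rfl⟩ | ⟨u, hu, rfl⟩)
    · refine ⟨x, hx, ?_⟩
      have h := dist_sumElim_left (penalized id K A.proj.1 (firstBlock x)) (firstBlock x)
        (fun j => x (Sum.inr j))
      rw [show Sum.elim (firstBlock x) (fun j => x (Sum.inr j)) = x from
        Sum.elim_comp_inl_inr x] at h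
      exact h.trans (hK _ ⟨x, hx, rfl⟩)
    · refine ⟨_, penalized_mem continuous_firstBlock (Nat.cast_nonneg K) A.2 u, ?_⟩
      have h := dist_sumElim_left u (penalized id K A.proj.1 u)
        (fun j => penalized firstBlock K A.1 u (Sum.inr j))
      rw [← firstBlock_penalized, show Sum.elim (firstBlock (penalized firstBlock K A.1 u))
        (fun j => penalized firstBlock K A.1 u (Sum.inr j)) = penalized firstBlock K A.1 u from
        Sum.elim_comp_inl_inr _, firstBlock_penalized] at h
      refine h.trans ?_
      rw [dist_comm]
      exact hK u hu
  · refine ⟨_, subset_maxPlusHull _ (Or.inl ⟨x, hx, rfl⟩), ?_⟩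
    have h := dist_sumElim_left (penalized id K A.proj.1 (firstBlock x)) (firstBlock x)
      (fun j => x (Sum.inr j))
    rw [show Sum.elim (firstBlock x) (fun j => x (Sum.inr j)) = x from
      Sum.elim_comp_inl_inr x] at h
    rw [dist_comm]
    exact h.trans (hK _ ⟨x, hx, rfl⟩)

end Sections

/-- A sequence of continuous sections of `proj` whose values are dense in every fibre. -/
theorem exists_dense_sections (ι κ : Type*) [CoordWeight ι] [CoordWeight κ] [Countable ι]
    [Countable κ] :
    ∃ x : ℕ → MaxPlusCompacts ι → MaxPlusCompacts (ι ⊕ κ), (∀ k, Continuous (x k)) ∧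
      (∀ k b, (x k b).proj = b) ∧
      ∀ A : MaxPlusCompacts (ι ⊕ κ), ∀ ε > 0, ∃ k, dist (x k A.proj) A < ε := by
  have : Nonempty (MaxPlusCompacts (ι ⊕ κ)) := ⟨⟨{0}, by simpa using maxPlusConvex_singleton _⟩⟩
  refine ⟨fun k b => (denseSeq (MaxPlusCompacts (ι ⊕ κ)) k.unpair.1).moveTo k.unpair.2 b,
    fun k => ?_, fun k b => MaxPlusCompacts.proj_moveTo _ _ _, fun A ε hε => ?_⟩
  · have e : Continuous fun b : MaxPlusCompacts ι =>
        (denseSeq (MaxPlusCompacts (ι ⊕ κ)) k.unpair.1, b) := by fun_prop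
    have h := (MaxPlusCompacts.continuous_moveTo (ι := ι) (κ := κ) k.unpair.2).comp e
    exact h
  · obtain ⟨K, hK⟩ := A.exists_dist_moveTo_le (half_pos hε)
    have hc : Continuous fun A' : MaxPlusCompacts (ι ⊕ κ) => A'.moveTo K A.proj := by
      have e : Continuous fun A' : MaxPlusCompacts (ι ⊕ κ) => (A', A.proj) := by fun_prop
      have h := (MaxPlusCompacts.continuous_moveTo (ι := ι) (κ := κ) K).comp e
      exact h
    have hopen : IsOpen {A' : MaxPlusCompacts (ι ⊕ κ) | dist (A'.moveTo K A.proj) A < ε} :=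
      isOpen_lt (hc.dist continuous_const) continuous_const
    obtain ⟨A', hA', j, rfl⟩ := (denseRange_denseSeq (MaxPlusCompacts (ι ⊕ κ))).inter_open_nonempty
      _ hopen ⟨A, by simp only [mem_ofPred_eq]; linarith⟩
    refine ⟨Nat.pair j K, ?_⟩
    simpa using hA'

section Comb

variable {η : Type*}

/-- The coefficients of a countable max-plus combination, written multiplicatively. -/
structure IsCoef (l : ℕ → ℝ) : Prop where
  nonneg : ∀ k, 0 ≤ l k
  exists_max : ∃ k₀, 0 < l k₀ ∧ ∀ k, l k ≤ l k₀

/-- The normalized countable max-plus combination of the points `a k` with coefficients `l k`,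
written multiplicatively. -/
noncomputable def comb (l : ℕ → ℝ) (a : ℕ → η → ℝ) : η → ℝ := fun j =>
  Real.log (⨆ k, l k * Real.exp (a k j)) - Real.log (⨆ k, l k)

/-- The suprema defining `comb l a` are finite. -/
def CombBdd (l : ℕ → ℝ) (a : ℕ → η → ℝ) : Prop :=
  ∀ j, BddAbove (range fun k => l k * Real.exp (a k j))

namespace IsCoef

variable {l m : ℕ → ℝ} {a a' a'' : ℕ → η → ℝ}

theorem isGreatest_iSup (hl : IsCoef l) : IsGreatest (range l) (⨆ k, l k) := by
  obtain ⟨k₀, -, h⟩ := hl.exists_max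
  have : IsGreatest (range l) (l k₀) := ⟨⟨k₀, rfl⟩, by rintro _ ⟨k, rfl⟩; exact h k⟩
  rwa [← this.isLUB.csSup_eq (range_nonempty l)] at this

theorem le_iSup (hl : IsCoef l) (k : ℕ) : l k ≤ ⨆ k, l k := hl.isGreatest_iSup.2 ⟨k, rfl⟩

theorem exists_eq_iSup (hl : IsCoef l) : ∃ k, l k = ⨆ k, l k := hl.isGreatest_iSup.1

theorem iSup_pos (hl : IsCoef l) : 0 < ⨆ k, l k := by
  obtain ⟨k₀, h, -⟩ := hl.exists_max
  exact h.trans_le (hl.le_iSup k₀)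

theorem comb_le_iff (hl : IsCoef l) (ha : CombBdd l a) {j : η} {c : ℝ} :
    comb l a j ≤ c ↔ ∀ k, 0 < l k → Real.log (l k) + a k j ≤ c + Real.log (⨆ k, l k) := by
  obtain ⟨k₀, h0, -⟩ := hl.exists_max
  have hpos : 0 < ⨆ k, l k * Real.exp (a k j) :=
    (mul_pos h0 (Real.exp_pos _)).trans_le (le_ciSup (ha j) k₀)
  rw [comb, sub_le_iff_le_add, Real.log_le_iff_le_exp hpos, ciSup_le_iff (ha j)]
  refine forall_congr' fun k => ?_
  rcases (hl.nonneg k).eq_or_lt with h | h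
  · simp [← h, Real.exp_nonneg]
  · rw [← Real.log_le_iff_le_exp (mul_pos h (Real.exp_pos _)),
      Real.log_mul h.ne' (Real.exp_pos _).ne', Real.log_exp]
    simp [h]

theorem log_add_le (hl : IsCoef l) (ha : CombBdd l a) {k : ℕ} (hk : 0 < l k) (j : η) :
    Real.log (l k) + a k j ≤ comb l a j + Real.log (⨆ k, l k) :=
  (hl.comb_le_iff ha).1 le_rfl k hk

theorem comb_const (hl : IsCoef l) (x : η → ℝ) : comb l (fun _ => x) = x := by
  funext j
  rw [comb, ← Real.iSup_mul_of_nonneg (Real.exp_nonneg _),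
    Real.log_mul hl.iSup_pos.ne' (Real.exp_pos _).ne', Real.log_exp]
  ring

theorem comb_max (hl : IsCoef l) (ha : CombBdd l a) (ha' : CombBdd l a') {t : ℝ} :
    comb l (fun k j => max (a k j) (t + a' k j)) = fun j => max (comb l a j) (t + comb l a' j) := by
  have hb : CombBdd l (fun k j => max (a k j) (t + a' k j)) := by
    intro j
    obtain ⟨C, hC⟩ := ha j
    obtain ⟨C', hC'⟩ := ha' j
    refine ⟨max C (Real.exp t * C'), ?_⟩
    rintro _ ⟨k, rfl⟩
    have h1 := hC ⟨k, rfl⟩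
    have h2 := hC' ⟨k, rfl⟩
    simp only at h1 h2 ⊢
    rcases max_choice (a k j) (t + a' k j) with h | h
    · rw [h]
      exact le_max_of_le_left h1
    · rw [h, Real.exp_add]
      refine le_max_of_le_right ?_
      nlinarith [Real.exp_pos t]
  funext j
  refine eq_of_forall_ge_iff fun c => ?_
  rw [hl.comb_le_iff hb, max_le_iff, ← le_sub_iff_add_le', hl.comb_le_iff ha, hl.comb_le_iff ha',
    ← forall_and]
  refine forall_congr' fun k => ?_
  rw [← imp_and]
  refine imp_congr_right fun _ => ?_
  rw [← max_add_add_left, max_le_iff]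
  refine and_congr Iff.rfl ?_
  constructor <;> intro h <;> linarith

/-- A countable max-plus combination lies in a closed max-plus convex set if it can be rewritten as
a combination of members of that set, one of them being itself a countable combination. -/
theorem comb_mem {N : Set (η → ℝ)} (hN : MaxPlusConvex N) (hc : IsClosed N) (hl : IsCoef l)
    (ha'' : CombBdd l a'') {r : ℝ} (hr : 0 ≤ r) (P : ℕ → Prop)
    (hnot : ∀ k, ¬ P k → l k = r * m k ∧ a'' k = a k)
    (hP : ∀ k, P k → r * m k ≤ l k ∧ (0 < l k → a' k ∈ N ∧ ∀ j, a'' k j =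
      if 0 < r * m k then max (a' k j) (Real.log (r * m k) - Real.log (l k) + a k j) else a' k j))
    (hm : 0 < r → IsCoef m ∧ CombBdd m a ∧ comb m a ∈ N) : comb l a'' ∈ N := by
  have hle : ∀ k, r * m k ≤ l k := fun k => by
    by_cases h : P k
    · exact (hP k h).1
    · exact (hnot k h).1.ge
  have hS := hl.iSup_pos
  refine hN.mem_of_isLUB hc
    (T := {q | (0 < r ∧ q = (Real.log r + Real.log (⨆ k, m k) - Real.log (⨆ k, l k), comb m a)) ∨
      ∃ k, P k ∧ 0 < l k ∧ q = (Real.log (l k) - Real.log (⨆ k, l k), a' k)}) ?_ ?_ fun j => ?_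
  · rintro q (⟨h0, rfl⟩ | ⟨k, hk, h0, rfl⟩)
    · refine ⟨?_, (hm h0).2.2⟩
      obtain ⟨k, hk⟩ := (hm h0).1.exists_eq_iSup
      rw [← Real.log_mul h0.ne' (hm h0).1.iSup_pos.ne', sub_nonpos]
      refine Real.log_le_log (mul_pos h0 (hm h0).1.iSup_pos) ?_
      rw [← hk]
      exact (hle k).trans (hl.le_iSup k)
    · refine ⟨?_, ((hP k hk).2 h0).1⟩
      rw [sub_nonpos]
      exact Real.log_le_log h0 (hl.le_iSup k)
  · obtain ⟨k, hk⟩ := hl.exists_eq_iSup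
    have h0 : 0 < l k := hk ▸ hS
    by_cases h : P k
    · exact ⟨a' k, Or.inr ⟨k, h, h0, by rw [hk, sub_self]⟩⟩
    · have hlk := (hnot k h).1
      have hr0 : 0 < r := by
        rcases hr.eq_or_lt with h' | h'
        · rw [← h', zero_mul] at hlk
          linarith
        · exact h'
      refine ⟨comb m a, Or.inl ⟨hr0, ?_⟩⟩
      have heq : r * (⨆ k, m k) = ⨆ k, l k := by
        refine le_antisymm ?_ ?_
        · obtain ⟨k', hk'⟩ := (hm hr0).1.exists_eq_iSup
          rw [← hk']
          exact (hle k').trans (hl.le_iSup k')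
        · rw [← hk, hlk]
          exact mul_le_mul_of_nonneg_left ((hm hr0).1.le_iSup k) hr
      rw [← Real.log_mul hr0.ne' (hm hr0).1.iSup_pos.ne', heq, sub_self]
  · constructor
    · rintro _ ⟨q, ⟨h0, rfl⟩ | ⟨k, hk, h0, rfl⟩, rfl⟩
      · simp only
        obtain ⟨hm1, hm2, -⟩ := hm h0
        have : comb m a j ≤ comb l a'' j + Real.log (⨆ k, l k) - Real.log r
            - Real.log (⨆ k, m k) := by
          rw [hm1.comb_le_iff hm2]
          intro k hk
          have hrm : 0 < r * m k := mul_pos h0 hk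
          have hlk : 0 < l k := hrm.trans_le (hle k)
          have h1 := hl.log_add_le ha'' hlk j
          have h2 : Real.log (r * m k) = Real.log r + Real.log (m k) :=
            Real.log_mul h0.ne' hk.ne'
          by_cases h : P k
          · have h3 := ((hP k h).2 hlk).2 j
            rw [if_pos hrm] at h3
            have h4 := le_max_right (a' k j) (Real.log (r * m k) - Real.log (l k) + a k j)
            linarith
          · rw [(hnot k h).2, (hnot k h).1] at h1
            linarith
        linarith
      · simp only
        have h1 := hl.log_add_le ha'' h0 j
        have h3 := ((hP k hk).2 h0).2 j
        have h4 : a' k j ≤ a'' k j := by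
          rw [h3]
          split_ifs
          · exact le_max_left _ _
          · exact le_rfl
        linarith
    · intro c hcub
      rw [hl.comb_le_iff ha'']
      have hmk : ∀ k, 0 < r * m k → Real.log (r * m k) + a k j ≤ c + Real.log (⨆ k, l k) := by
        intro k hk
        have h0 : 0 < r := by
          rcases hr.eq_or_lt with h' | h'
          · rw [← h', zero_mul] at hk
            exact absurd hk (lt_irrefl _)
          · exact h'
        obtain ⟨hm1, hm2, -⟩ := hm h0
        have hk' : 0 < m k := pos_of_mul_pos_right hk hr
        have h1 := hm1.log_add_le hm2 hk' j
        have h2 := hcub ⟨_, Or.inl ⟨h0, rfl⟩, rfl⟩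
        simp only at h2
        rw [Real.log_mul h0.ne' hk'.ne']
        linarith
      intro k hk
      by_cases h : P k
      · have h2 := hcub ⟨_, Or.inr ⟨k, h, hk, rfl⟩, rfl⟩
        simp only at h2
        rw [((hP k h).2 hk).2 j]
        split_ifs with h3
        · have := hmk k h3
          rw [← max_add_add_left]
          exact max_le (by linarith) (by linarith)
        · linarith
      · rw [(hnot k h).2]
        rw [(hnot k h).1] at hk ⊢
        exact hmk k hk

end IsCoef

end Comb

/-- The product of a sequence of nonempty compact sets. -/
def piCompacts {Y : Type*} [TopologicalSpace Y] (x : ℕ → NonemptyCompacts Y) :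
    NonemptyCompacts (ℕ → Y) :=
  ⟨⟨Set.pi univ fun k => (x k : Set Y), isCompact_univ_pi fun k => (x k).isCompact⟩,
    univ_pi_nonempty_iff.2 fun k => (x k).nonempty⟩

theorem mem_piCompacts {Y : Type*} [TopologicalSpace Y] {x : ℕ → NonemptyCompacts Y} {a : ℕ → Y} :
    a ∈ piCompacts x ↔ ∀ k, a k ∈ x k := mem_univ_pi

section

open scoped PiCountable

theorem continuous_piCompacts {Y : Type*} [MetricSpace Y] :
    Continuous (piCompacts (Y := Y)) := by
  let _ : EMetricSpace (ℕ → Y) := PiCountable.emetricSpace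
  have h : LipschitzWith 1 (piCompacts (Y := Y)) := by
    intro x x'
    rw [ENNReal.coe_one, one_mul]
    have key : ∀ x x' : ℕ → NonemptyCompacts Y, ∀ a ∈ piCompacts x,
        ∃ b ∈ piCompacts x', edist a b ≤ edist x x' := by
      intro x x' a ha
      have hex : ∀ k, ∃ b ∈ x' k, dist (a k) b ≤ dist (x k) (x' k) := fun k =>
        ((NonemptyCompacts.dist_le_iff dist_nonneg).1 le_rfl).1 (a k) (mem_piCompacts.1 ha k)
      choose b hb hab using hex
      refine ⟨b, mem_piCompacts.2 hb, ENNReal.tsum_le_tsum fun k => min_le_min le_rfl ?_⟩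
      rw [edist_dist, edist_dist]
      exact ENNReal.ofReal_le_ofReal (hab k)
    refine Metric.hausdorffEDist_le_of_mem_edist (key x x') ?_
    intro a ha
    obtain ⟨b, hb, h⟩ := key x' x a ha
    exact ⟨b, hb, by rwa [edist_comm x x']⟩
  exact h.continuous

end

theorem continuous_iSup_of_locally_tendsto {P : Type*} [TopologicalSpace P] {g : P → ℕ → ℝ}
    (hg : ∀ k, Continuous fun p => g p k) (h0 : ∀ p k, 0 ≤ g p k)
    (hloc : ∀ p, ∃ u : ℕ → ℝ, Tendsto u atTop (𝓝 0) ∧ ∃ n, ∀ᶠ q in 𝓝 p, ∀ k, n ≤ k → g q k ≤ u k) :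
    Continuous fun p => ⨆ k, g p k := by
  have hbdd : ∀ p, BddAbove (range (g p)) := by
    intro p
    obtain ⟨u, hu, n, hn⟩ := hloc p
    have h1 := (eventually_ge_atTop n).mono fun k hk => hn.self_of_nhds k hk
    have h2 : Tendsto (g p) atTop (𝓝 0) :=
      tendsto_of_tendsto_of_tendsto_of_le_of_le' tendsto_const_nhds hu
        (Eventually.of_forall (h0 p)) h1
    exact h2.bddAbove_range
  refine continuous_iff_lower_upperSemicontinuous.2 ⟨?_, ?_⟩
  · exact lowerSemicontinuous_ciSup hbdd fun k => (hg k).lowerSemicontinuous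
  · intro p c hc
    obtain ⟨d, hd, hdc⟩ := exists_between hc
    have hd0 : 0 < d := lt_of_le_of_lt (Real.iSup_nonneg (h0 p)) hd
    obtain ⟨u, hu, n, hn⟩ := hloc p
    obtain ⟨N, hN⟩ := eventually_atTop.1 (hu.eventually_lt_const hd0)
    have hfin : ∀ᶠ q in 𝓝 p, ∀ k ∈ Finset.range (max n N), g q k < d := by
      rw [eventually_all_finset]
      intro k _
      exact ((hg k).tendsto p).eventually_lt_const ((le_ciSup (hbdd p) k).trans_lt hd)
    filter_upwards [hn, hfin] with q hq hq'
    refine lt_of_le_of_lt (ciSup_le fun k => ?_) hdc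
    rcases lt_or_ge k (max n N) with hk | hk
    · exact (hq' k (Finset.mem_range.2 hk)).le
    · exact (hq k ((le_max_left _ _).trans hk)).trans (hN k ((le_max_right _ _).trans hk)).le

section Combination

variable {η : Type*} [Denumerable η]

/-- A bound for the first `k + 1` coordinates of the points of a compact set. -/
noncomputable def coordBound (k : ℕ) (A : NonemptyCompacts (η → ℝ)) : ℝ :=
  ∑ n ∈ Finset.range (k + 1), max 0 (supOn (fun y => y (Denumerable.ofNat η n)) A)

theorem coordBound_nonneg (k : ℕ) (A : NonemptyCompacts (η → ℝ)) : 0 ≤ coordBound k A :=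
  Finset.sum_nonneg fun _ _ => le_max_left _ _

theorem le_coordBound {k : ℕ} {A : NonemptyCompacts (η → ℝ)} {y : η → ℝ} (hy : y ∈ A) {j : η}
    (hj : Encodable.encode j ≤ k) : y j ≤ coordBound k A := by
  have h1 := le_supOn (continuous_apply (A := fun _ : η => ℝ) j) hy
  have h2 := Finset.single_le_sum (s := Finset.range (k + 1))
    (f := fun n => max 0 (supOn (fun y : η → ℝ => y (Denumerable.ofNat η n)) A))
    (fun _ _ => le_max_left _ _) (Finset.mem_range.2 (Nat.lt_succ_of_le hj))
  simp only [Denumerable.ofNat_encode] at h2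
  exact (h1.trans (le_max_right _ _)).trans h2

theorem continuous_coordBound (k : ℕ) : Continuous (coordBound (η := η) k) := by
  refine continuous_finsetSum _ fun n _ => continuous_const.max ?_
  exact Continuous.supOn (P := NonemptyCompacts (η → ℝ)) (h := fun _ y => y (Denumerable.ofNat η n))
    ((continuous_apply _).comp continuous_snd) continuous_id

/-- The coefficients attached to a summable sequence. -/
noncomputable def coef (x : ℕ → NonemptyCompacts (η → ℝ)) (z : ellOne) (k : ℕ) : ℝ :=
  max (z k) 0 * Real.exp (-(k : ℝ) - coordBound k (x k))

/-- Truncation of a coordinate which does not affect the points of `A`. -/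
noncomputable def clip (A : NonemptyCompacts (η → ℝ)) (k : ℕ) (y : η → ℝ) : η → ℝ := fun j =>
  if Encodable.encode j ≤ k then min (y j) (coordBound k A) else y j

theorem clip_eq_self {A : NonemptyCompacts (η → ℝ)} {y : η → ℝ} (hy : y ∈ A) (k : ℕ) :
    clip A k y = y := by
  funext j
  rw [clip]
  split_ifs with h
  · exact min_eq_left (le_coordBound hy h)
  · rfl

theorem continuous_clip (k : ℕ) (j : η) :
    Continuous fun q : NonemptyCompacts (η → ℝ) × (η → ℝ) => clip q.1 k q.2 j := by
  unfold clip
  split_ifs with h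
  · exact ((continuous_apply j).comp continuous_snd).min
      ((continuous_coordBound k).comp continuous_fst)
  · exact (continuous_apply j).comp continuous_snd

theorem continuous_ellOne_apply (k : ℕ) : Continuous fun z : ellOne => z k := by
  refine LipschitzWith.continuous (K := 1) (LipschitzWith.of_dist_le_mul fun z z' => ?_)
  rw [NNReal.coe_one, one_mul, dist_eq_norm, dist_eq_norm]
  exact lp.norm_apply_le_norm one_ne_zero (z - z') k

theorem max_apply_le_norm (z : ellOne) (k : ℕ) : max (z k) 0 ≤ ‖z‖ :=
  max_le ((le_abs_self _).trans (lp.norm_apply_le_norm one_ne_zero z k)) (norm_nonneg z)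

theorem coef_nonneg (x : ℕ → NonemptyCompacts (η → ℝ)) (z : ellOne) (k : ℕ) : 0 ≤ coef x z k :=
  mul_nonneg (le_max_right _ _) (Real.exp_nonneg _)

theorem coef_le (x : ℕ → NonemptyCompacts (η → ℝ)) (z : ellOne) (k : ℕ) :
    coef x z k ≤ ‖z‖ * Real.exp (-(k : ℝ)) := by
  refine mul_le_mul (max_apply_le_norm z k) (Real.exp_le_exp.2 ?_) (Real.exp_nonneg _)
    (norm_nonneg z)
  linarith [coordBound_nonneg k (x k)]

theorem coef_mul_exp_clip_le (x : ℕ → NonemptyCompacts (η → ℝ)) (z : ellOne) (a : ℕ → η → ℝ)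
    {k : ℕ} {j : η} (hj : Encodable.encode j ≤ k) :
    coef x z k * Real.exp (clip (x k) k (a k) j) ≤ ‖z‖ * Real.exp (-(k : ℝ)) := by
  rw [coef, mul_assoc, ← Real.exp_add, clip, if_pos hj]
  refine mul_le_mul (max_apply_le_norm z k) (Real.exp_le_exp.2 ?_) (Real.exp_nonneg _)
    (norm_nonneg z)
  linarith [min_le_right (a k j) (coordBound k (x k))]

theorem tendsto_mul_exp_neg (C : ℝ) :
    Tendsto (fun k : ℕ => C * Real.exp (-(k : ℝ))) atTop (𝓝 0) := by
  simpa using (Real.tendsto_exp_neg_atTop_nhds_zero.comp tendsto_natCast_atTop_atTop).const_mul C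

theorem coef_pos_iff {x : ℕ → NonemptyCompacts (η → ℝ)} {z : ellOne} {k : ℕ} :
    0 < coef x z k ↔ 0 < z k := by
  rw [coef, mul_pos_iff_of_pos_right (Real.exp_pos _)]
  simp

theorem isCoef_coef (x : ℕ → NonemptyCompacts (η → ℝ)) {z : ellOne} (hz : ∃ k, 0 < z k) :
    IsCoef (coef x z) := by
  refine ⟨coef_nonneg x z, ?_⟩
  obtain ⟨k₁, hk₁⟩ := hz
  have h1 : 0 < coef x z k₁ := coef_pos_iff.2 hk₁
  have ht : Tendsto (coef x z) atTop (𝓝 0) :=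
    tendsto_of_tendsto_of_tendsto_of_le_of_le tendsto_const_nhds (tendsto_mul_exp_neg ‖z‖)
      (coef_nonneg x z) (coef_le x z)
  obtain ⟨N, hN⟩ := eventually_atTop.1 (ht.eventually_lt_const h1)
  obtain ⟨k₀, hk₀, hmax⟩ := Finset.exists_max_image (Finset.range (max N (k₁ + 1))) (coef x z)
    ⟨k₁, by simp⟩
  have h2 : coef x z k₁ ≤ coef x z k₀ := hmax k₁ (by simp)
  refine ⟨k₀, h1.trans_le h2, fun k => ?_⟩
  rcases lt_or_ge k (max N (k₁ + 1)) with hk | hk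
  · exact hmax k (Finset.mem_range.2 hk)
  · exact (hN k ((le_max_left _ _).trans hk)).le.trans h2

theorem combBdd_coef {x : ℕ → NonemptyCompacts (η → ℝ)} {a : ℕ → η → ℝ} (ha : ∀ k, a k ∈ x k)
    (z : ellOne) : CombBdd (coef x z) a := by
  intro j
  have ht : Tendsto (fun k => coef x z k * Real.exp (a k j)) atTop (𝓝 0) := by
    refine tendsto_of_tendsto_of_tendsto_of_le_of_le' tendsto_const_nhds (tendsto_mul_exp_neg ‖z‖)
      (Eventually.of_forall fun k => mul_nonneg (coef_nonneg x z k) (Real.exp_nonneg _)) ?_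
    filter_upwards [eventually_ge_atTop (Encodable.encode j)] with k hk
    have h := coef_mul_exp_clip_le x z a hk
    rwa [clip_eq_self (ha k)] at h
  exact ht.bddAbove_range

/-- The sequences with some positive term. -/
abbrev PosSeq : Type := {z : ellOne // ∃ k, 0 < z k}

/-- The combination of the points `a k` with the coefficients attached to `z`. -/
noncomputable def clippedComb (x : ℕ → NonemptyCompacts (η → ℝ)) (z : ellOne) (a : ℕ → η → ℝ) :
    η → ℝ := comb (coef x z) fun k => clip (x k) k (a k)

theorem clippedComb_eq {x : ℕ → NonemptyCompacts (η → ℝ)} {a : ℕ → η → ℝ} (ha : ∀ k, a k ∈ x k)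
    (z : ellOne) : clippedComb x z a = comb (coef x z) a := by
  rw [clippedComb]
  congr 1
  funext k
  exact clip_eq_self (ha k) k

theorem continuous_coef (k : ℕ) :
    Continuous fun q : (ℕ → NonemptyCompacts (η → ℝ)) × ellOne => coef q.1 q.2 k := by
  have h1 : Continuous fun q : (ℕ → NonemptyCompacts (η → ℝ)) × ellOne => coordBound k (q.1 k) :=
    (continuous_coordBound k).comp ((continuous_apply k).comp continuous_fst)
  have h2 : Continuous fun q : (ℕ → NonemptyCompacts (η → ℝ)) × ellOne => q.2 k :=
    (continuous_ellOne_apply k).comp continuous_snd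
  exact (h2.max continuous_const).mul (Real.continuous_exp.comp (continuous_const.sub h1))

theorem continuous_clippedComb : Continuous
    fun q : ((ℕ → NonemptyCompacts (η → ℝ)) × PosSeq) × (ℕ → η → ℝ) =>
      clippedComb q.1.1 q.1.2.1 q.2 := by
  have hz : Continuous fun q : ((ℕ → NonemptyCompacts (η → ℝ)) × PosSeq) × (ℕ → η → ℝ) =>
      q.1.2.1 := continuous_subtype_val.comp (continuous_snd.comp continuous_fst)
  have hcoef : ∀ k, Continuous fun q : ((ℕ → NonemptyCompacts (η → ℝ)) × PosSeq) × (ℕ → η → ℝ) =>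
      coef q.1.1 q.1.2.1 k := fun k => by
    have h := (continuous_coef (η := η) k).comp ((continuous_fst.comp continuous_fst).prodMk hz)
    exact h
  have hnorm : ∀ p : ((ℕ → NonemptyCompacts (η → ℝ)) × PosSeq) × (ℕ → η → ℝ),
      ∀ᶠ q in 𝓝 p, ‖q.1.2.1‖ ≤ ‖p.1.2.1‖ + 1 := fun p =>
    (hz.norm.tendsto p).eventually_le_const (lt_add_one _)
  refine continuous_pi fun j => ?_
  have hclip : ∀ k, Continuous fun q : ((ℕ → NonemptyCompacts (η → ℝ)) × PosSeq) × (ℕ → η → ℝ) =>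
      clip (q.1.1 k) k (q.2 k) j := fun k => by
    have e : Continuous fun q : ((ℕ → NonemptyCompacts (η → ℝ)) × PosSeq) × (ℕ → η → ℝ) =>
        (q.1.1 k, q.2 k) := by fun_prop
    have h := (continuous_clip k j).comp e
    exact h
  have h1 : Continuous fun q : ((ℕ → NonemptyCompacts (η → ℝ)) × PosSeq) × (ℕ → η → ℝ) =>
      ⨆ k, coef q.1.1 q.1.2.1 k * Real.exp (clip (q.1.1 k) k (q.2 k) j) := by
    refine continuous_iSup_of_locally_tendsto
      (fun k => (hcoef k).mul (Real.continuous_exp.comp (hclip k)))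
      (fun p k => mul_nonneg (coef_nonneg _ _ _) (Real.exp_nonneg _)) fun p => ?_
    refine ⟨_, tendsto_mul_exp_neg (‖p.1.2.1‖ + 1), Encodable.encode j, ?_⟩
    filter_upwards [hnorm p] with q hq k hk
    exact (coef_mul_exp_clip_le _ _ _ hk).trans
      (mul_le_mul_of_nonneg_right hq (Real.exp_nonneg _))
  have h2 : Continuous fun q : ((ℕ → NonemptyCompacts (η → ℝ)) × PosSeq) × (ℕ → η → ℝ) =>
      ⨆ k, coef q.1.1 q.1.2.1 k := by
    refine continuous_iSup_of_locally_tendsto hcoef (fun p k => coef_nonneg _ _ _) fun p => ?_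
    refine ⟨_, tendsto_mul_exp_neg (‖p.1.2.1‖ + 1), 0, ?_⟩
    filter_upwards [hnorm p] with q hq k hk
    exact (coef_le _ _ _).trans (mul_le_mul_of_nonneg_right hq (Real.exp_nonneg _))
  refine (h1.log fun q => ?_).sub (h2.log fun q => (isCoef_coef _ q.1.2.2).iSup_pos.ne')
  have hb : BddAbove (range fun k => coef q.1.1 q.1.2.1 k *
      Real.exp (clip (q.1.1 k) k (q.2 k) j)) := by
    have ht : Tendsto (fun k => coef q.1.1 q.1.2.1 k *
        Real.exp (clip (q.1.1 k) k (q.2 k) j)) atTop (𝓝 0) := by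
      refine tendsto_of_tendsto_of_tendsto_of_le_of_le' tendsto_const_nhds
        (tendsto_mul_exp_neg ‖q.1.2.1‖) (Eventually.of_forall fun k =>
          mul_nonneg (coef_nonneg _ _ k) (Real.exp_nonneg _)) ?_
      filter_upwards [eventually_ge_atTop (Encodable.encode j)] with k hk
      exact coef_mul_exp_clip_le _ _ _ hk
    exact ht.bddAbove_range
  obtain ⟨k, hk⟩ := q.1.2.2
  exact ((mul_pos (coef_pos_iff.2 hk) (Real.exp_pos _)).trans_le (le_ciSup hb k)).ne'

theorem continuous_clippedComb_right (x : ℕ → NonemptyCompacts (η → ℝ)) (z : PosSeq) :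
    Continuous (clippedComb x z.1) := by
  have e : Continuous fun a : ℕ → η → ℝ => ((x, z), a) := by fun_prop
  have h := (continuous_clippedComb (η := η)).comp e
  exact h

/-- The set of all combinations of points of the sets `x k` with the coefficients attached to
`z`. -/
noncomputable def MaxPlusCompacts.combination (x : ℕ → MaxPlusCompacts η) (z : PosSeq) :
    MaxPlusCompacts η :=
  ⟨(piCompacts fun k => (x k).1).map (clippedComb (fun k => (x k).1) z.1)
    (continuous_clippedComb_right _ z), by
    rintro _ ⟨a, ha, rfl⟩ _ ⟨b, hb, rfl⟩ t ht
    have ha := mem_piCompacts.1 ha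
    have hb := mem_piCompacts.1 hb
    have hab : ∀ k, (fun j => max (a k j) (t + b k j)) ∈ (x k).1 := fun k =>
      (x k).2 _ (ha k) _ (hb k) t ht
    refine ⟨fun k j => max (a k j) (t + b k j), mem_piCompacts.2 hab, ?_⟩
    rw [clippedComb_eq ha, clippedComb_eq hb, clippedComb_eq hab,
      (isCoef_coef _ z.2).comb_max (combBdd_coef ha _) (combBdd_coef hb _)]⟩

theorem MaxPlusCompacts.mem_combination {x : ℕ → MaxPlusCompacts η} {z : PosSeq} {y : η → ℝ} :
    y ∈ (combination x z).1 ↔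
      ∃ a, (∀ k, a k ∈ (x k).1) ∧ comb (coef (fun k => (x k).1) z.1) a = y := by
  constructor
  · rintro ⟨a, ha, rfl⟩
    have ha := mem_piCompacts.1 ha
    exact ⟨a, ha, (clippedComb_eq ha z.1).symm⟩
  · rintro ⟨a, ha, rfl⟩
    exact ⟨a, mem_piCompacts.2 ha, clippedComb_eq ha z.1⟩

theorem MaxPlusCompacts.continuous_combination [CoordWeight η] : Continuous
    fun q : (ℕ → MaxPlusCompacts η) × PosSeq => combination q.1 q.2 := by
  refine Continuous.subtype_mk ?_ _
  have e : Continuous fun q : (ℕ → MaxPlusCompacts η) × PosSeq => fun k => (q.1 k).1 := by fun_prop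
  have h1 : Continuous fun q : (ℕ → MaxPlusCompacts η) × PosSeq => piCompacts fun k => (q.1 k).1 := by
    have h := (continuous_piCompacts (Y := η → ℝ)).comp e
    exact h
  have h2 : Continuous fun q : ((ℕ → MaxPlusCompacts η) × PosSeq) × (ℕ → η → ℝ) =>
      clippedComb (fun k => (q.1.1 k).1) q.1.2.1 q.2 := by
    have e' : Continuous fun q : ((ℕ → MaxPlusCompacts η) × PosSeq) × (ℕ → η → ℝ) =>
        (((fun k => (q.1.1 k).1), q.1.2), q.2) := by fun_prop
    have h := (continuous_clippedComb (η := η)).comp e'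
    exact h
  exact Continuous.nonemptyCompacts_map'
    (g := fun (q : (ℕ → MaxPlusCompacts η) × PosSeq) (a : ℕ → η → ℝ) =>
      clippedComb (fun k => (q.1 k).1) q.2.1 a) h1 h2

end Combination

section Combination

theorem coef_eq_mul {η : Type*} [Denumerable η] (x : ℕ → NonemptyCompacts (η → ℝ)) {u v : ellOne}
    {c : ℝ} {k : ℕ} (h : max (v k) 0 = c * max (u k) 0) : coef x v k = c * coef x u k := by
  rw [coef, coef, h, mul_assoc]

theorem mul_coef_le {η : Type*} [Denumerable η] (x : ℕ → NonemptyCompacts (η → ℝ)) {u v : ellOne}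
    {c : ℝ} {k : ℕ} (h : c * max (u k) 0 ≤ max (v k) 0) : c * coef x u k ≤ coef x v k := by
  rw [coef, coef, ← mul_assoc]
  exact mul_le_mul_of_nonneg_right h (Real.exp_nonneg _)

namespace MaxPlusCompacts

theorem dist_combination_le {η : Type*} [Denumerable η] [CoordWeight η]
    {x : ℕ → MaxPlusCompacts η} {y : MaxPlusCompacts η} {M c : ℝ} (hM : 0 ≤ M) (hc : 0 ≤ c)
    {v : PosSeq} {u : ellOne}
    (h : ∀ k, max (v.1 k) 0 = c * max (u k) 0 ∨
      (c * max (u k) 0 ≤ max (v.1 k) 0 ∧ dist (x k) y ≤ M))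
    (hu : 0 < c → ∃ hu : ∃ k, 0 < u k, dist (combination x ⟨u, hu⟩) y ≤ M) :
    dist (combination x v) y ≤ M := by
  have hl := isCoef_coef (fun k => (x k).1) v.2
  let P : ℕ → Prop := fun k => c * max (u k) 0 ≤ max (v.1 k) 0 ∧ dist (x k) y ≤ M
  have hnotP : ∀ k, ¬ P k → max (v.1 k) 0 = c * max (u k) 0 := fun k hk =>
    (h k).resolve_right hk
  refine (NonemptyCompacts.dist_le_iff hM).2 ⟨fun w hw => ?_, fun ξ hξ => ?_⟩
  · obtain ⟨a, ha, rfl⟩ := mem_combination.1 hw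
    refine IsCoef.comb_mem (N := nearSet y.1 M) (a := a) (a' := a) (m := coef (fun k => (x k).1) u)
      (r := c) (maxPlusConvex_nearSet y.2 M) (isClosed_nearSet y.1.isCompact M) hl
      (combBdd_coef ha _) hc P (fun k hk => ⟨coef_eq_mul _ (hnotP k hk), rfl⟩)
      (fun k hk => ⟨mul_coef_le _ hk.1, fun h0 => ⟨?_, fun j => ?_⟩⟩) fun h0 => ?_
    · exact ((NonemptyCompacts.dist_le_iff hM).1 hk.2).1 _ (ha k)
    · split_ifs with h1
      · have := Real.log_le_log h1 (mul_coef_le (fun k => (x k).1) hk.1)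
        exact (max_eq_left (by linarith)).symm
      · rfl
    · obtain ⟨hu', hd⟩ := hu h0
      exact ⟨isCoef_coef _ hu', combBdd_coef ha _,
        ((NonemptyCompacts.dist_le_iff hM).1 hd).1 _ (mem_combination.2 ⟨a, ha, rfl⟩)⟩
  · have hex : ∃ a : ℕ → η → ℝ, (∀ k, a k ∈ (x k).1) ∧
        (0 < c → dist ξ (comb (coef (fun k => (x k).1) u) a) ≤ M) := by
      by_cases h0 : 0 < c
      · obtain ⟨hu', hd⟩ := hu h0
        obtain ⟨w, hw, hd'⟩ := ((NonemptyCompacts.dist_le_iff hM).1 hd).2 ξ hξ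
        obtain ⟨a, ha, rfl⟩ := mem_combination.1 hw
        exact ⟨a, ha, fun _ => hd'⟩
      · choose a ha using fun k => (x k).1.nonempty
        exact ⟨a, ha, fun h => absurd h h0⟩
    obtain ⟨a, ha, had⟩ := hex
    have hex' : ∀ k, ∃ b ∈ (x k).1, P k → dist ξ b ≤ M := by
      intro k
      by_cases hk : P k
      · obtain ⟨b, hb, hd⟩ := ((NonemptyCompacts.dist_le_iff hM).1 hk.2).2 ξ hξ
        exact ⟨b, hb, fun _ => hd⟩
      · exact ⟨a k, ha k, fun h => absurd h hk⟩
    choose b hb hbd using hex'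
    classical
    let e : ℕ → η → ℝ := fun k => if P k then
      (if 0 < c * coef (fun k => (x k).1) u k then fun j => max (b k j)
        (Real.log (c * coef (fun k => (x k).1) u k) - Real.log (coef (fun k => (x k).1) v.1 k)
          + a k j) else b k) else a k
    have he : ∀ k, e k ∈ (x k).1 := by
      intro k
      simp only [e]
      split_ifs with h1 h2
      · refine (x k).2 _ (hb k) _ (ha k) _ ?_
        have := Real.log_le_log h2 (mul_coef_le (fun k => (x k).1) h1.1)
        linarith
      · exact hb k
      · exact ha k
    refine ⟨comb (coef (fun k => (x k).1) v.1) e, mem_combination.2 ⟨e, he, rfl⟩, ?_⟩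
    have hmem : comb (coef (fun k => (x k).1) v.1) e ∈ nearSet {ξ} M := by
      refine IsCoef.comb_mem (a := a) (a' := b) (m := coef (fun k => (x k).1) u)
        (r := c) (maxPlusConvex_nearSet (maxPlusConvex_singleton ξ) M)
        (isClosed_nearSet isCompact_singleton M) hl
        (combBdd_coef he _) hc P (fun k hk => ⟨coef_eq_mul _ (hnotP k hk), if_neg hk⟩)
        (fun k hk => ⟨mul_coef_le _ hk.1, fun h0 => ⟨?_, fun j => ?_⟩⟩) fun h0 => ?_
      · exact ⟨ξ, rfl, by rw [dist_comm]; exact hbd k hk⟩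
      · simp only [e, if_pos hk]
        split_ifs <;> rfl
      · exact ⟨isCoef_coef _ (hu h0).1, combBdd_coef ha _, ξ, rfl, by
          rw [dist_comm]; exact had h0⟩
    obtain ⟨_, rfl, hd⟩ := hmem
    rwa [dist_comm]

theorem proj_combination {ι κ : Type*} [Denumerable (ι ⊕ κ)] {x : ℕ → MaxPlusCompacts (ι ⊕ κ)}
    {b : MaxPlusCompacts ι} (hx : ∀ k, (x k).proj = b) (z : PosSeq) :
    (combination x z).proj = b := by
  have hl := isCoef_coef (fun k => (x k).1) z.2
  refine Subtype.ext (SetLike.coe_injective (Subset.antisymm ?_ ?_))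
  · rintro _ ⟨w, hw, rfl⟩
    obtain ⟨a, ha, rfl⟩ := mem_combination.1 hw
    have hb : ∀ k, firstBlock (a k) ∈ b.1 := fun k => by
      rw [← hx k]
      exact mem_proj.2 ⟨a k, ha k, rfl⟩
    exact IsCoef.comb_mem (N := b.1) (a := fun k => firstBlock (a k))
      (a' := fun k => firstBlock (a k)) (a'' := fun k => firstBlock (a k)) (m := 0) (r := 0)
      b.2 b.1.isCompact.isClosed hl (fun i => combBdd_coef ha z.1 (Sum.inl i)) le_rfl
      (fun _ => True) (by simp) (fun k _ => ⟨by simpa using coef_nonneg _ _ _, fun _ =>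
        ⟨hb k, by simp⟩⟩) (by simp)
  · intro ξ hξ
    have hex : ∀ k, ∃ a ∈ (x k).1, firstBlock a = ξ := fun k => by
      rw [← mem_proj, hx k]
      exact hξ
    choose a ha hξa using hex
    refine mem_proj.2 ⟨_, mem_combination.2 ⟨a, ha, rfl⟩, ?_⟩
    have h1 : (fun k => firstBlock (a k)) = fun _ => ξ := funext hξa
    have h2 := hl.comb_const ξ
    rw [← h1] at h2
    exact h2

theorem combination_eq_of_forall_ne {η : Type*} [Denumerable η] {x : ℕ → MaxPlusCompacts η}
    {z : PosSeq} {k : ℕ} (hz : ∀ n, n ≠ k → z.1 n ≤ 0) : combination x z = x k := by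
  have hl := isCoef_coef (fun k => (x k).1) z.2
  have hn : ∀ n, 0 < coef (fun k => (x k).1) z.1 n → n = k := fun n h => by
    by_contra hne
    exact absurd (coef_pos_iff.1 h) (hz n hne).not_gt
  have hmax : coef (fun k => (x k).1) z.1 k = ⨆ n, coef (fun k => (x k).1) z.1 n := by
    obtain ⟨n, h⟩ := hl.exists_eq_iSup
    rwa [hn n (h ▸ hl.iSup_pos)] at h
  have hk : 0 < coef (fun k => (x k).1) z.1 k := hmax ▸ hl.iSup_pos
  have key : ∀ a : ℕ → η → ℝ, (∀ n, a n ∈ (x n).1) →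
      comb (coef (fun k => (x k).1) z.1) a = a k := by
    intro a ha
    funext j
    refine le_antisymm ((hl.comb_le_iff (combBdd_coef ha _)).2 fun n h => ?_) ?_
    · rw [hn n h, ← hmax, add_comm]
    · have := hl.log_add_le (combBdd_coef ha z.1) hk j
      rw [← hmax] at this
      linarith
  refine Subtype.ext (SetLike.coe_injective (Subset.antisymm ?_ ?_))
  · intro w hw
    obtain ⟨a, ha, rfl⟩ := mem_combination.1 hw
    rw [key a ha]
    exact ha k
  · intro w hw
    choose a ha using fun n => (x n).1.nonempty
    have ha' : ∀ n, Function.update a k w n ∈ (x n).1 := fun n => by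
      by_cases h : n = k
      · subst h
        rw [Function.update_self]
        exact hw
      · rw [Function.update_of_ne h]
        exact ha n
    exact mem_combination.2 ⟨_, ha', by rw [key _ ha', Function.update_self]⟩

end MaxPlusCompacts

end Combination

theorem exists_continuous_ellOne {S : Type*} [TopologicalSpace S] {g : S → ℕ → ℝ}
    (hg : ∀ k, Continuous fun s => g s k) (h : ∀ s k, |g s k| ≤ (1 / 2 : ℝ) ^ k) :
    ∃ c : S → ellOne, Continuous c ∧ ∀ s k, c s k = g s k := by
  have hmem : ∀ s, Memℓp (g s) 1 := fun s => memℓp_gen <| by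
    simpa using Summable.of_nonneg_of_le (fun k => abs_nonneg _) (h s) summable_geometric_two
  refine ⟨fun s => ⟨g s, hmem s⟩, ?_, fun s k => rfl⟩
  have heq : ∀ s, (∑' k, lp.single (E := fun _ : ℕ => ℝ) 1 k (g s k)) = (⟨g s, hmem s⟩ : ellOne) :=
    fun s => (lp.hasSum_single ENNReal.one_ne_top (⟨g s, hmem s⟩ : ellOne)).tsum_eq
  have hc : Continuous fun s => ∑' k, lp.single (E := fun _ : ℕ => ℝ) 1 k (g s k) := by
    refine continuous_tsum (fun k => ?_) summable_geometric_two fun k s => ?_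
    · exact (lp.isometry_single (E := fun _ : ℕ => ℝ) (p := 1) k).continuous.comp (hg k)
    · rw [lp.norm_single (by norm_num)]
      exact h s k
  exact hc.congr heq

theorem exists_continuous_center {S : Type*} [TopologicalSpace S] {F : S → ℕ → ℝ}
    (hF : ∀ k, Continuous fun s => F s k) (hneg : ∀ s, ∃ k, F s k < 0) :
    ∃ (c : S → ellOne) (m : S → ℝ), Continuous c ∧ (∀ s, 0 < m s) ∧ (∀ s k, 0 ≤ c s k) ∧
      (∀ s k, 0 < c s k → F s k ≤ -m s) ∧ ∀ s, ∃ k, 0 < c s k := by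
  let g : S → ℕ → ℝ := fun s k => (1 / 2 : ℝ) ^ k * min 1 (max (-F s k) 0)
  have hpow : ∀ k : ℕ, 0 < (1 / 2 : ℝ) ^ k := fun k => by positivity
  have hpow1 : ∀ k : ℕ, (1 / 2 : ℝ) ^ k ≤ 1 := fun k => pow_le_one₀ (by norm_num) (by norm_num)
  have hgc : ∀ k, Continuous fun s => g s k := fun k => by
    have := hF k
    fun_prop
  have hg0 : ∀ s k, 0 ≤ g s k := fun s k =>
    mul_nonneg (hpow k).le (le_min zero_le_one (le_max_right _ _))
  have hg1 : ∀ s k, g s k ≤ (1 / 2 : ℝ) ^ k := fun s k =>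
    mul_le_of_le_one_right (hpow k).le (min_le_left _ _)
  have htend : Tendsto (fun k : ℕ => (1 / 2 : ℝ) ^ k) atTop (𝓝 0) :=
    tendsto_pow_atTop_nhds_zero_of_lt_one (by norm_num) (by norm_num)
  have hm : Continuous fun s => ⨆ k, g s k :=
    continuous_iSup_of_locally_tendsto hgc hg0 fun s =>
      ⟨_, htend, 0, Eventually.of_forall fun s k _ => hg1 s k⟩
  have hbdd : ∀ s, BddAbove (range (g s)) := fun s =>
    ⟨1, by rintro _ ⟨k, rfl⟩; exact (hg1 s k).trans (hpow1 k)⟩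
  have hpos : ∀ s, 0 < ⨆ k, g s k := fun s => by
    obtain ⟨k, hk⟩ := hneg s
    refine lt_of_lt_of_le (mul_pos (hpow k) (lt_min one_pos ?_)) (le_ciSup (hbdd s) k)
    exact lt_max_of_lt_left (by linarith)
  let m : S → ℝ := fun s => (⨆ k, g s k) / 2
  have hmc : Continuous m := hm.div_const 2
  let w : S → ℕ → ℝ := fun s k => (1 / 2 : ℝ) ^ k * min 1 (max (-F s k - m s) 0)
  have hw0 : ∀ s k, 0 ≤ w s k := fun s k =>
    mul_nonneg (hpow k).le (le_min zero_le_one (le_max_right _ _))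
  obtain ⟨c, hc, hcw⟩ := exists_continuous_ellOne (g := w)
    (fun k => by have := hF k; fun_prop) fun s k => by
      rw [abs_of_nonneg (hw0 s k)]
      exact mul_le_of_le_one_right (hpow k).le (min_le_left _ _)
  refine ⟨c, m, hc, fun s => half_pos (hpos s), fun s k => (hcw s k) ▸ hw0 s k,
    fun s k h => ?_, fun s => ?_⟩
  · by_contra hlt
    rw [hcw] at h
    have : max (-F s k - m s) 0 = 0 := max_eq_right (by linarith)
    simp [w, this] at h
  · obtain ⟨k, hk⟩ := exists_lt_of_lt_ciSup (show m s < ⨆ k, g s k from half_lt_self (hpos s))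
    refine ⟨k, ?_⟩
    rw [hcw]
    refine mul_pos (hpow k) (lt_min one_pos (lt_max_of_lt_left ?_))
    have h1 : g s k ≤ max (-F s k) 0 :=
      (mul_le_of_le_one_left (le_min zero_le_one (le_max_right _ _)) (hpow1 k)).trans
        (min_le_right _ _)
    have hmp : 0 < m s := half_pos (hpos s)
    rcases lt_max_iff.1 (hk.trans_le h1) with h | h <;> linarith

section Sections

variable {ι κ : Type} [Denumerable (ι ⊕ κ)]
  {x : ℕ → MaxPlusCompacts ι → MaxPlusCompacts (ι ⊕ κ)}

open Classical in
/-- The combination of the values of the sections `x k` at `q.1` with the coefficients attached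
to `q.2`. -/
noncomputable def sectionComb (x : ℕ → MaxPlusCompacts ι → MaxPlusCompacts (ι ⊕ κ))
    (q : MaxPlusCompacts ι × ellOne) : MaxPlusCompacts (ι ⊕ κ) :=
  if h : ∃ k, 0 < q.2 k then MaxPlusCompacts.combination (fun k => x k q.1) ⟨q.2, h⟩ else x 0 q.1

theorem sectionComb_of_exists {b : MaxPlusCompacts ι} {z : ellOne} (h : ∃ k, 0 < z k) :
    sectionComb x (b, z) = MaxPlusCompacts.combination (fun k => x k b) ⟨z, h⟩ := dif_pos h

theorem isOpen_setOf_exists_pos {B : Type*} [TopologicalSpace B] :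
    IsOpen {q : B × ellOne | ∃ k, 0 < q.2 k} := by
  have : {q : B × ellOne | ∃ k, 0 < q.2 k} = ⋃ k, {q | 0 < q.2 k} := by
    ext q
    simp
  rw [this]
  exact isOpen_iUnion fun k =>
    isOpen_lt continuous_const ((continuous_ellOne_apply k).comp continuous_snd)

theorem continuousOn_sectionComb [CoordWeight ι] [CoordWeight κ] (hx : ∀ k, Continuous (x k)) :
    ContinuousOn (sectionComb x) {q | ∃ k, 0 < q.2 k} := by
  rw [continuousOn_iff_continuous_domRestrict]
  have e : Continuous fun q : {q : MaxPlusCompacts ι × ellOne | ∃ k, 0 < q.2 k} =>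
      ((fun k => x k q.1.1), (⟨q.1.2, q.2⟩ : PosSeq)) := by
    refine Continuous.prodMk (continuous_pi fun k => ?_) (Continuous.subtype_mk ?_ _)
    · have e1 : Continuous fun q : {q : MaxPlusCompacts ι × ellOne | ∃ k, 0 < q.2 k} => q.1.1 := by
        fun_prop
      exact (hx k).comp e1
    · fun_prop
  have h := (MaxPlusCompacts.continuous_combination (η := ι ⊕ κ)).comp e
  exact h.congr fun q => (sectionComb_of_exists (x := x) (b := q.1.1) (z := q.1.2) q.2).symm

/-- The functions on the fibre over `b` whose sublevel sets are stable under enlarging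
coefficients at sections lying in the sublevel set. -/
def SectionAdmissible (x : ℕ → MaxPlusCompacts ι → MaxPlusCompacts (ι ⊕ κ))
    (b : MaxPlusCompacts ι) (f : MaxPlusCompacts (ι ⊕ κ) → ℝ) : Prop :=
  ∀ (M c : ℝ) (v u : ellOne), 0 ≤ c → (∃ k, 0 < v k) →
    (∀ k, max (v k) 0 = c * max (u k) 0 ∨ (c * max (u k) 0 ≤ max (v k) 0 ∧ f (x k b) ≤ M)) →
    (0 < c → (∃ k, 0 < u k) ∧ f (sectionComb x (b, u)) ≤ M) → f (sectionComb x (b, v)) ≤ M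

namespace SectionAdmissible

variable {b : MaxPlusCompacts ι} {f g : MaxPlusCompacts (ι ⊕ κ) → ℝ}

theorem exists_le {M c : ℝ} {v u : ellOne} (hc : 0 ≤ c) (hv : ∃ k, 0 < v k)
    (h : ∀ k, max (v k) 0 = c * max (u k) 0 ∨ (c * max (u k) 0 ≤ max (v k) 0 ∧ f (x k b) ≤ M))
    (hu : 0 < c → (∃ k, 0 < u k) ∧ f (sectionComb x (b, u)) ≤ M) : ∃ A, f A ≤ M := by
  rcases hc.eq_or_lt with rfl | h0
  · obtain ⟨k, hk⟩ := hv
    rcases h k with h | h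
    · rw [zero_mul] at h
      have := le_max_left (v k) 0
      linarith
    · exact ⟨_, h.2⟩
  · exact ⟨_, (hu h0).2⟩

theorem const (a : ℝ) : SectionAdmissible x b fun _ => a := fun _ _ _ _ hc hv h hu =>
  (exists_le (x := x) (b := b) (f := fun _ => a) hc hv h hu).elim fun _ h => h

theorem max (hf : SectionAdmissible x b f) (hg : SectionAdmissible x b g) :
    SectionAdmissible x b fun A => max (f A) (g A) := fun M c v u hc hv h hu =>
  max_le
    (hf M c v u hc hv
      (fun k => (h k).imp id fun h => ⟨h.1, (le_max_left _ _).trans h.2⟩)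
      fun h0 => ⟨(hu h0).1, (le_max_left _ _).trans (hu h0).2⟩)
    (hg M c v u hc hv
      (fun k => (h k).imp id fun h => ⟨h.1, (le_max_right _ _).trans h.2⟩)
      fun h0 => ⟨(hu h0).1, (le_max_right _ _).trans (hu h0).2⟩)

theorem add_const (hf : SectionAdmissible x b f) (a : ℝ) :
    SectionAdmissible x b fun A => f A + a := fun M c v u hc hv h hu =>
  le_sub_iff_add_le.1 (hf (M - a) c v u hc hv
    (fun k => (h k).imp id fun h => ⟨h.1, le_sub_iff_add_le.2 h.2⟩)
    fun h0 => ⟨(hu h0).1, le_sub_iff_add_le.2 (hu h0).2⟩)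

theorem dist [CoordWeight ι] [CoordWeight κ] (y : MaxPlusCompacts (ι ⊕ κ)) : SectionAdmissible x b fun A => dist A y := by
  intro M c v u hc hv h hu
  have hM : 0 ≤ M := (exists_le (f := fun A => Dist.dist A y) hc hv h hu).elim fun _ h => dist_nonneg.trans h
  rw [sectionComb_of_exists hv]
  refine MaxPlusCompacts.dist_combination_le hM hc h fun h0 => ?_
  obtain ⟨hu', hd⟩ := hu h0
  rw [sectionComb_of_exists hu'] at hd
  exact ⟨hu', hd⟩

end SectionAdmissible

variable [CoordWeight ι] [CoordWeight κ]

theorem trivialOver_sublevel (hx : ∀ k, Continuous (x k)) (hp : ∀ k b, (x k b).proj = b)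
    (hd : ∀ A : MaxPlusCompacts (ι ⊕ κ), ∀ ε > 0, ∃ k, dist (x k A.proj) A < ε)
    {S : Type} [TopologicalSpace S] [MetrizableSpace S] {β : S → MaxPlusCompacts ι}
    (hβ : Continuous β) {f : S → MaxPlusCompacts (ι ⊕ κ) → ℝ}
    (hf : Continuous fun q : S × MaxPlusCompacts (ι ⊕ κ) => f q.1 q.2)
    (ha : ∀ s, SectionAdmissible x (β s) (f s))
    (hne : ∀ s, ∃ z : ellOne, (∃ k, 0 < z k) ∧ f s (sectionComb x (β s, z)) < 0) :
    TrivialOver ellOne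
      {q : S × ellOne | (∃ k, 0 < q.2 k) ∧ f q.1 (sectionComb x (β q.1, q.2)) < 0} := by
  have hneg : ∀ s, ∃ k, f s (x k (β s)) < 0 := by
    intro s
    obtain ⟨z, hz, hz0⟩ := hne s
    have e : Continuous fun A : MaxPlusCompacts (ι ⊕ κ) => (s, A) := by fun_prop
    have hfs : Continuous (f s) := by
      have h := hf.comp e
      exact h
    obtain ⟨ε, hε, h⟩ := Metric.isOpen_iff.1 (isOpen_lt hfs continuous_const) _ hz0
    have hproj : (sectionComb x (β s, z)).proj = β s := by
      rw [sectionComb_of_exists hz]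
      exact MaxPlusCompacts.proj_combination (fun k => hp k _) _
    obtain ⟨k, hk⟩ := hd (sectionComb x (β s, z)) ε hε
    rw [hproj] at hk
    exact ⟨k, h hk⟩
  obtain ⟨c, m, hc, hm, hc0, hcF, hcpos⟩ := exists_continuous_center
    (F := fun s k => f s (x k (β s)))
    (fun k => by
      have e : Continuous fun s => (s, x k (β s)) := continuous_id.prodMk ((hx k).comp hβ)
      have h := hf.comp e
      exact h) hneg
  refine trivialOver_of_starShaped ?_ hc (fun s => ?_) fun s v hv τ hτ0 hτ1 => ?_
  · have hβ' : Continuous fun q : S × ellOne => (β q.1, q.2) := by fun_prop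
    have hD : IsOpen {q : S × ellOne | ∃ k, 0 < q.2 k} := isOpen_setOf_exists_pos
    have h1 : ContinuousOn (fun q : S × ellOne => f q.1 (sectionComb x (β q.1, q.2)))
        {q : S × ellOne | ∃ k, 0 < q.2 k} := by
      refine hf.comp_continuousOn (continuousOn_fst.prodMk ?_)
      exact (continuousOn_sectionComb hx).comp hβ'.continuousOn fun q hq => hq
    exact h1.isOpen_inter_preimage hD isOpen_Iio
  · refine ⟨hcpos s, (ha s (-m s) 0 (c s) 0 le_rfl (hcpos s) (fun k => ?_)
      fun h => absurd h (lt_irrefl _)).trans_lt (neg_lt_zero.2 (hm s))⟩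
    simp only [zero_mul]
    rcases (hc0 s k).eq_or_lt with h | h
    · exact Or.inl (by rw [← h, max_self])
    · exact Or.inr ⟨le_max_right _ _, hcF s k h⟩
  · obtain ⟨⟨k₀, hk₀⟩, hv0⟩ := hv
    have happ : ∀ k, (c s + τ • (v - c s) : ellOne) k = τ * v k + (1 - τ) * c s k := fun k => by
      change c s k + τ * (v k - c s k) = _
      ring
    have hw : ∃ k, 0 < (c s + τ • (v - c s) : ellOne) k := by
      rcases hτ0.eq_or_lt with h | h
      · obtain ⟨k, hk⟩ := hcpos s
        refine ⟨k, ?_⟩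
        rw [happ, ← h]
        linarith
      · refine ⟨k₀, ?_⟩
        rw [happ]
        have h1 := mul_pos h hk₀
        have h2 := mul_nonneg (sub_nonneg.2 hτ1) (hc0 s k₀)
        linarith
    refine ⟨hw, (ha s (Max.max (f s (sectionComb x (β s, v))) (-m s)) τ _ v hτ0 hw (fun k => ?_)
      fun h => ⟨⟨k₀, hk₀⟩, le_max_left _ _⟩).trans_lt (max_lt hv0 (neg_lt_zero.2 (hm s)))⟩
    rw [happ]
    have hτc := mul_nonneg (sub_nonneg.2 hτ1) (hc0 s k)
    rcases (hc0 s k).eq_or_lt with h | h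
    · left
      rw [← h, mul_zero, add_zero, mul_max_of_nonneg _ _ hτ0, mul_zero]
    · refine Or.inr ⟨?_, (hcF s k h).trans (le_max_right _ _)⟩
      rw [mul_max_of_nonneg _ _ hτ0, mul_zero]
      exact max_le_max (by linarith) le_rfl

/-- The absorption data given by a dense sequence of sections. -/
noncomputable def sectionAbsorptionData (hx : ∀ k, Continuous (x k))
    (hp : ∀ k b, (x k b).proj = b)
    (hd : ∀ A : MaxPlusCompacts (ι ⊕ κ), ∀ ε > 0, ∃ k, dist (x k A.proj) A < ε) :
    AbsorptionData (MaxPlusCompacts (ι ⊕ κ)) (MaxPlusCompacts ι) ellOne where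
  p := MaxPlusCompacts.proj
  continuous_p := MaxPlusCompacts.continuous_proj
  D := {q | ∃ k, 0 < q.2 k}
  isOpen_D := isOpen_setOf_exists_pos
  r := sectionComb x
  continuousOn_r := continuousOn_sectionComb hx
  p_r := fun ⟨b, z⟩ hq => by
    rw [sectionComb_of_exists hq]
    exact MaxPlusCompacts.proj_combination (fun k => hp k _) _
  exists_mem_D := fun b => ⟨lp.single 1 0 1, 0, by simp⟩
  dense_r := fun A ε hε => by
    obtain ⟨k, hk⟩ := hd A ε hε
    have hz : ∃ n, 0 < (lp.single 1 k 1 : ellOne) n := ⟨k, by simp⟩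
    refine ⟨lp.single 1 k 1, hz, ?_⟩
    rw [sectionComb_of_exists hz, MaxPlusCompacts.combination_eq_of_forall_ne (k := k)]
    · exact hk
    · intro n hn
      simp [lp.single_apply, hn]
  Adm := SectionAdmissible x
  adm_const := fun b a => SectionAdmissible.const a
  adm_dist := fun y => SectionAdmissible.dist y
  adm_max := fun b f g hf hg => hf.max hg
  adm_add := fun b f a hf => hf.add_const a
  trivial_sublevel := fun S _ _ β hβ f hf ha hne => trivialOver_sublevel hx hp hd hβ hf ha hne

end Sections

theorem exists_homeomorph_prod_seq (ι κ : Type) [CoordWeight ι] [CoordWeight κ] [Countable ι]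
    [Countable κ] [Denumerable (ι ⊕ κ)] :
    ∃ h : MaxPlusCompacts (ι ⊕ κ) × (ℕ → ℝ × ellOne) ≃ₜ MaxPlusCompacts ι × (ℕ → ℝ × ellOne),
      ∀ q, (h q).1 = q.1.proj := by
  obtain ⟨x, hx, hp, hd⟩ := exists_dense_sections ι κ
  have : Inhabited ellOne := ⟨0⟩
  exact (sectionAbsorptionData hx hp hd).exists_homeomorph

section Translation

variable {ι κ : Type*}

/-- Translation of the second block of coordinates. -/
def shiftPoint (y : κ → ℝ) (a : ι ⊕ κ → ℝ) : ι ⊕ κ → ℝ :=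
  Sum.elim (fun i => a (Sum.inl i)) fun j => a (Sum.inr j) + y j

theorem continuous_shiftPoint :
    Continuous fun q : (κ → ℝ) × (ι ⊕ κ → ℝ) => shiftPoint q.1 q.2 := by
  refine continuous_pi ?_
  rintro (i | j)
  · change Continuous fun q : (κ → ℝ) × (ι ⊕ κ → ℝ) => q.2 (Sum.inl i)
    fun_prop
  · change Continuous fun q : (κ → ℝ) × (ι ⊕ κ → ℝ) => q.2 (Sum.inr j) + q.1 j
    fun_prop

theorem continuous_shiftPoint_right (y : κ → ℝ) : Continuous (shiftPoint (ι := ι) y) := by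
  have e : Continuous fun a : ι ⊕ κ → ℝ => (y, a) := by fun_prop
  have h := (continuous_shiftPoint (ι := ι) (κ := κ)).comp e
  exact h

namespace MaxPlusCompacts

/-- Translation of a set along the second block of coordinates. -/
def translate (y : κ → ℝ) (A : MaxPlusCompacts (ι ⊕ κ)) : MaxPlusCompacts (ι ⊕ κ) :=
  ⟨A.1.map (shiftPoint y) (continuous_shiftPoint_right y), by
    rintro _ ⟨a, ha, rfl⟩ _ ⟨b, hb, rfl⟩ t ht
    refine ⟨_, A.2 a ha b hb t ht, funext ?_⟩
    rintro (i | j)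
    · rfl
    · change max (a (Sum.inr j)) (t + b (Sum.inr j)) + y j =
        max (a (Sum.inr j) + y j) (t + (b (Sum.inr j) + y j))
      rw [← max_add_add_right, add_assoc]⟩

theorem proj_translate (y : κ → ℝ) (A : MaxPlusCompacts (ι ⊕ κ)) : (A.translate y).proj = A.proj := by
  refine Subtype.ext (SetLike.coe_injective ?_)
  change firstBlock '' (shiftPoint y '' (A.1 : Set (ι ⊕ κ → ℝ))) =
    firstBlock '' (A.1 : Set (ι ⊕ κ → ℝ))
  rw [image_image]
  rfl

theorem translate_translate_of_add_eq_zero {y y' : κ → ℝ} (h : y + y' = 0)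
    (A : MaxPlusCompacts (ι ⊕ κ)) : (A.translate y).translate y' = A := by
  refine Subtype.ext (SetLike.coe_injective ?_)
  change shiftPoint y' '' (shiftPoint y '' (A.1 : Set (ι ⊕ κ → ℝ))) = (A.1 : Set (ι ⊕ κ → ℝ))
  rw [image_image]
  convert image_id _ using 2
  funext a
  refine funext ?_
  rintro (i | j)
  · rfl
  · have := congrFun h j
    simp only [Pi.add_apply, Pi.zero_apply] at this
    simp [shiftPoint, add_assoc, this]

theorem continuous_translate [CoordWeight ι] [CoordWeight κ] :
    Continuous fun q : (κ → ℝ) × MaxPlusCompacts (ι ⊕ κ) => q.2.translate q.1 := by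
  refine Continuous.subtype_mk ?_ _
  have e : Continuous fun q : ((κ → ℝ) × MaxPlusCompacts (ι ⊕ κ)) × (ι ⊕ κ → ℝ) =>
      (q.1.1, q.2) := by fun_prop
  have h := (continuous_shiftPoint (ι := ι) (κ := κ)).comp e
  have h1 : Continuous fun q : (κ → ℝ) × MaxPlusCompacts (ι ⊕ κ) => q.2.1 := by fun_prop
  exact Continuous.nonemptyCompacts_map'
    (g := fun (q : (κ → ℝ) × MaxPlusCompacts (ι ⊕ κ)) (a : ι ⊕ κ → ℝ) => shiftPoint q.1 a) h1 h

/-- The suprema of the coordinates of the second block. -/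
noncomputable def height (A : MaxPlusCompacts (ι ⊕ κ)) : κ → ℝ := fun j =>
  supOn (fun a => a (Sum.inr j)) A.1

theorem continuous_height [CoordWeight ι] [CoordWeight κ] :
    Continuous (height (ι := ι) (κ := κ)) := by
  refine continuous_pi fun j => ?_
  have h1 : Continuous fun A : MaxPlusCompacts (ι ⊕ κ) => A.1 := continuous_subtype_val
  exact Continuous.supOn (h := fun _ a => a (Sum.inr j))
    ((continuous_apply _).comp continuous_snd) h1

theorem height_translate (y : κ → ℝ) (A : MaxPlusCompacts (ι ⊕ κ)) :
    (A.translate y).height = A.height + y := by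
  funext j
  have hj : Continuous fun a : ι ⊕ κ → ℝ => a (Sum.inr j) := continuous_apply _
  refine le_antisymm ((supOn_le_iff hj).2 ?_) ?_
  · rintro _ ⟨a, ha, rfl⟩
    exact add_le_add_left (le_supOn hj ha) _
  · obtain ⟨a, ha, h⟩ := exists_eq_supOn hj A.1
    change supOn _ _ + _ ≤ _
    rw [← h]
    exact le_supOn hj (show shiftPoint y a ∈ (A.translate y).1 from ⟨a, ha, rfl⟩)

/-- Splitting off a factor of the space of heights. -/
noncomputable def splitHomeomorph {ι : Type*} [CoordWeight ι] :
    MaxPlusCompacts (ι ⊕ ℕ) ≃ₜ MaxPlusCompacts (ι ⊕ ℕ) × (ℕ → ℝ) where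
  toFun A := (A.translate ((seqPairHomeomorph.symm A.height).1 - A.height),
    (seqPairHomeomorph.symm A.height).2)
  invFun q := q.1.translate (seqPairHomeomorph (q.1.height, q.2) - q.1.height)
  left_inv A := by
    simp only [height_translate, add_sub_cancel, Prod.mk.eta, Homeomorph.apply_symm_apply]
    exact translate_translate_of_add_eq_zero (by abel) A
  right_inv q := by
    simp only [height_translate, add_sub_cancel, Homeomorph.symm_apply_apply]
    exact Prod.ext (translate_translate_of_add_eq_zero (by abel) q.1) rfl
  continuous_toFun := by
    have h1 := continuous_height (ι := ι) (κ := ℕ)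
    have h2 : Continuous fun A : MaxPlusCompacts (ι ⊕ ℕ) => seqPairHomeomorph.symm A.height :=
      seqPairHomeomorph.symm.continuous.comp h1
    have e : Continuous fun A : MaxPlusCompacts (ι ⊕ ℕ) =>
        ((seqPairHomeomorph.symm A.height).1 - A.height, A) :=
      (h2.fst.sub h1).prodMk continuous_id
    have h3 := (continuous_translate (ι := ι) (κ := ℕ)).comp e
    exact h3.prodMk h2.snd
  continuous_invFun := by
    have h1 : Continuous fun q : MaxPlusCompacts (ι ⊕ ℕ) × (ℕ → ℝ) => q.1.height :=
      (continuous_height (ι := ι) (κ := ℕ)).comp continuous_fst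
    have h2 : Continuous fun q : MaxPlusCompacts (ι ⊕ ℕ) × (ℕ → ℝ) =>
        seqPairHomeomorph (q.1.height, q.2) :=
      seqPairHomeomorph.continuous.comp (h1.prodMk continuous_snd)
    have e : Continuous fun q : MaxPlusCompacts (ι ⊕ ℕ) × (ℕ → ℝ) =>
        (seqPairHomeomorph (q.1.height, q.2) - q.1.height, q.1) :=
      (h2.sub h1).prodMk continuous_fst
    have h3 := (continuous_translate (ι := ι) (κ := ℕ)).comp e
    exact h3

theorem proj_splitHomeomorph {ι : Type*} [CoordWeight ι] (A : MaxPlusCompacts (ι ⊕ ℕ)) :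
    (splitHomeomorph A).1.proj = A.proj := proj_translate _ A

/-- The projection of `MaxPlusCompacts (ℕ ⊕ ℕ)` to the first block is a trivial bundle. -/
theorem exists_homeomorph_proj : ∃ h : MaxPlusCompacts (ℕ ⊕ ℕ) ≃ₜ MaxPlusCompacts ℕ × (ℕ → ℝ),
    ∀ A, (h A).1 = A.proj := by
  obtain ⟨g, hg⟩ := exists_homeomorph_prod_seq ℕ ℕ
  obtain ⟨e⟩ := nonempty_homeomorph_seq_ellOne_prod
  refine ⟨splitHomeomorph.trans <| ((Homeomorph.refl _).prodCongr e.symm).trans <|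
    (Homeomorph.prodAssoc _ _ _).symm.trans <| (g.prodCongr (Homeomorph.refl _)).trans <|
    (Homeomorph.prodAssoc _ _ _).trans <| (Homeomorph.refl _).prodCongr e, fun A => ?_⟩
  exact (hg _).trans (proj_splitHomeomorph A)

end MaxPlusCompacts

end Translation

end Hyperspaces

open Set Filter Topology Uniformity TopologicalSpace
open CoordWeight

theorem NonemptyCompacts.continuous_of_isOpen {X Z : Type*} [TopologicalSpace X]
    [TopologicalSpace Z] {f : Z → NonemptyCompacts X}
    (h1 : ∀ U : Set X, IsOpen U → IsOpen {z | (f z : Set X) ⊆ U})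
    (h2 : ∀ U : Set X, IsOpen U → IsOpen {z | ((f z : Set X) ∩ U).Nonempty}) : Continuous f := by
  refine continuous_induced_rng.2 (continuous_generateFrom_iff.2 ?_)
  rintro _ (⟨U, hU, rfl⟩ | ⟨U, hU, rfl⟩)
  · exact h1 U hU
  · exact h2 U hU

/-- Hyperspaces of max-plus convex sets given as sets correspond to those given as bundled
nonempty compact sets. -/
theorem exists_homeomorph_maxPlusCompacts {X ι : Type*} [TopologicalSpace X] (e : X ≃ₜ (ι → ℝ))
    (P : Set X → Prop)
    (hP : ∀ A, P A ↔ A.Nonempty ∧ IsCompact A ∧ MaxPlusConvex (e '' A)) :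
    letI : TopologicalSpace {A : Set X // P A} := vietoris P
    ∃ h : {A : Set X // P A} ≃ₜ MaxPlusCompacts ι, ∀ A, ((h A).1 : Set (ι → ℝ)) = e '' A.1 := by
  let _ : TopologicalSpace {A : Set X // P A} := vietoris P
  have hsub : ∀ U : Set X, IsOpen U → IsOpen {K : {A : Set X // P A} | (K : Set X) ⊆ U} :=
    fun U hU => isOpen_generateFrom_of_mem ⟨U, hU, Or.inl rfl⟩
  have hmeet : ∀ U : Set X, IsOpen U →
      IsOpen {K : {A : Set X // P A} | ((K : Set X) ∩ U).Nonempty} :=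
    fun U hU => isOpen_generateFrom_of_mem ⟨U, hU, Or.inr rfl⟩
  have hback : ∀ B : MaxPlusCompacts ι, P (e ⁻¹' (B.1 : Set (ι → ℝ))) := fun B => by
    rw [hP, image_preimage_eq _ e.surjective, e.isCompact_preimage]
    exact ⟨B.1.nonempty.preimage e.surjective, B.1.isCompact, B.2⟩
  refine ⟨{ toFun := fun A => ⟨⟨⟨e '' A.1, ((hP _).1 A.2).2.1.image e.continuous⟩,
              ((hP _).1 A.2).1.image e⟩, ((hP _).1 A.2).2.2⟩
            invFun := fun B => ⟨e ⁻¹' (B.1 : Set (ι → ℝ)), hback B⟩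
            left_inv := fun A => Subtype.ext (preimage_image_eq _ e.injective)
            right_inv := fun B => Subtype.ext
              (SetLike.coe_injective (image_preimage_eq _ e.surjective))
            continuous_toFun := ?_
            continuous_invFun := ?_ }, fun A => rfl⟩
  · refine Continuous.subtype_mk
      (NonemptyCompacts.continuous_of_isOpen (fun U hU => ?_) fun U hU => ?_) _
    · convert hsub _ (hU.preimage e.continuous) using 1
      ext A
      exact image_subset_iff
    · convert hmeet _ (hU.preimage e.continuous) using 1
      ext A
      exact image_inter_nonempty_iff
  · refine continuous_generateFrom_iff.2 ?_
    have hval : Continuous fun B : MaxPlusCompacts ι => B.1 := continuous_subtype_val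
    rintro _ ⟨U, hU, rfl | rfl⟩
    · convert (NonemptyCompacts.isOpen_subsets_of_isOpen (e.isOpenMap U hU)).preimage hval using 1
      ext B
      change e ⁻¹' (B.1 : Set (ι → ℝ)) ⊆ U ↔ (B.1 : Set (ι → ℝ)) ⊆ e '' U
      rw [← image_subset_image_iff e.injective, image_preimage_eq _ e.surjective]
    · convert (NonemptyCompacts.isOpen_inter_nonempty_of_isOpen (e.isOpenMap U hU)).preimage hval
        using 1
      ext B
      change (e ⁻¹' (B.1 : Set (ι → ℝ)) ∩ U).Nonempty ↔ ((B.1 : Set (ι → ℝ)) ∩ e '' U).Nonempty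
      rw [← image_nonempty (f := e), image_preimage_inter]

theorem maxPlusConvexPair_iff (A : Set ((ℕ → ℝ) × (ℕ → ℝ))) : MaxPlusConvexPair A ↔
    MaxPlusConvex ((Homeomorph.sumArrowHomeomorphProdArrow (X := ℝ)).symm '' A) := by
  have key : ∀ (a b : (ℕ → ℝ) × (ℕ → ℝ)) (t : ℝ),
      (fun i => max ((Homeomorph.sumArrowHomeomorphProdArrow (X := ℝ)).symm a i)
        (t + (Homeomorph.sumArrowHomeomorphProdArrow (X := ℝ)).symm b i)) =
      (Homeomorph.sumArrowHomeomorphProdArrow (X := ℝ)).symm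
        ((fun n => max (a.1 n) (t + b.1 n)), fun n => max (a.2 n) (t + b.2 n)) := by
    intro a b t
    funext i
    rcases i with i | i <;> rfl
  constructor
  · rintro h _ ⟨a, ha, rfl⟩ _ ⟨b, hb, rfl⟩ t ht
    exact ⟨_, h a ha b hb t ht, (key a b t).symm⟩
  · intro h a ha b hb t ht
    have h' := h _ ⟨a, ha, rfl⟩ _ ⟨b, hb, rfl⟩ t ht
    rw [key] at h'
    exact (Homeomorph.injective _).mem_set_image.1 h'

/-- `mpcc(p₁)` is a trivial bundle with fiber `ℝ^ω`: there is a homeomorphism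
`h : mpcc((ℕ → ℝ) × (ℕ → ℝ)) ≃ mpcc(ℕ → ℝ) × (ℕ → ℝ)` such that the first-factor
projection composed with `h` equals `mpcc(p₁)`. -/
theorem mpccP_trivial_bundle :
    letI : TopologicalSpace MPCC1 := vietoris _
    letI : TopologicalSpace MPCC2 := vietoris _
    ∃ h : MPCC2 ≃ₜ MPCC1 × (ℕ → ℝ), ∀ A : MPCC2, (h A).1 = mpccP A := by
  let _ : TopologicalSpace MPCC1 := vietoris _
  let _ : TopologicalSpace MPCC2 := vietoris _
  obtain ⟨h₁, hh₁⟩ := exists_homeomorph_maxPlusCompacts (Homeomorph.refl (ℕ → ℝ))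
    (fun A => A.Nonempty ∧ IsCompact A ∧ MaxPlusConvex A) fun A => by simp
  obtain ⟨h₂, hh₂⟩ := exists_homeomorph_maxPlusCompacts
    (Homeomorph.sumArrowHomeomorphProdArrow (X := ℝ) (ι := ℕ) (ι' := ℕ)).symm
    (fun A => A.Nonempty ∧ IsCompact A ∧ MaxPlusConvexPair A) fun A => by
      rw [maxPlusConvexPair_iff]
  obtain ⟨g, hg⟩ := MaxPlusCompacts.exists_homeomorph_proj
  refine ⟨h₂.trans (g.trans (h₁.symm.prodCongr (Homeomorph.refl _))), fun A => ?_⟩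
  change h₁.symm (g (h₂ A)).1 = mpccP A
  rw [hg, Homeomorph.symm_apply_eq]
  refine Subtype.ext (SetLike.coe_injective ?_)
  rw [hh₁]
  change firstBlock '' ((h₂ A).1 : Set (ℕ ⊕ ℕ → ℝ)) = id '' (Prod.fst '' A.1)
  rw [hh₂, image_id, image_image]
  rfl
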